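/- Fix 2 ≤ r ≤ n. Let Δ be a convex n-dimensional polytope in ℝ^n such that the Bezout inequality V(K_1,…,K_r,Δ[n−r])·V_n(Δ)^{r−1} ≤ ∏_{i=1}^r V(K_i,Δ[n−1]) holds for all convex bodies K_1,…,K_r in ℝ^n. Then Δ is a simplex. -/

import Mathlib

open Pointwise MeasureTheory

/-- The mixed volume of an `n`-tuple of sets in `ℝⁿ`, via the polarization formula
`V(K₁,…,Kₙ) = (1/n!) ∑_{S ⊆ [n]} (-1)^{n-|S|} vol(∑_{i∈S} Kᵢ)`. -/
noncomputable def mixedVol (n : ℕ) (K : Fin n → Set (EuclideanSpace ℝ (Fin n))) : ℝ :=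
  ((n.factorial : ℝ))⁻¹ *
    ∑ S : Finset (Fin n), (-1 : ℝ) ^ (n - S.card) * (volume (∑ i ∈ S, K i)).toReal

/-- A convex body: a nonempty compact convex set. -/
def IsConvexBody {n : ℕ} (K : Set (EuclideanSpace ℝ (Fin n))) : Prop :=
  Convex ℝ K ∧ IsCompact K ∧ K.Nonempty

theorem Real.volume_add_le_of_isCompact {A B : Set ℝ} (hA : IsCompact A) (hB : IsCompact B)
    (hA' : A.Nonempty) (hB' : B.Nonempty) : volume A + volume B ≤ volume (A + B) := by
  obtain ⟨a, ha, hamax⟩ := hA.exists_isGreatest hA'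
  obtain ⟨b, hb, hbmin⟩ := hB.exists_isLeast hB'
  have h1 : volume (A + {b}) = volume A := by
    rw [Set.add_singleton]; simp [measure_preimage_add_right]
  have h2 : volume ({a} + B) = volume B := by
    rw [Set.singleton_add]; simp
  have hdisj : AEDisjoint volume (A + {b}) ({a} + B) := by
    refine measure_mono_null (t := {a + b}) ?_ (by simp)
    rintro x ⟨hx, hy⟩
    rw [Set.add_singleton] at hx
    rw [Set.singleton_add] at hy
    obtain ⟨y, hy, rfl⟩ := hx
    obtain ⟨z, hz, hyz⟩ := hy
    have := hamax hy
    have := hbmin hz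
    simp only [Set.mem_singleton_iff]
    dsimp at hyz ⊢
    linarith
  rw [← h1, ← h2, ← measure_union₀ _ hdisj]
  · apply measure_mono
    exact Set.union_subset (Set.add_subset_add_left (by simpa using hb))
      (Set.add_subset_add_right (by simpa using ha))
  · exact (isCompact_singleton.add hB).measurableSet.nullMeasurableSet

theorem Real.volume_add_le {A B : Set ℝ} (hA : MeasurableSet A) (hB : MeasurableSet B)
    (hA' : A.Nonempty) (hB' : B.Nonempty) : volume A + volume B ≤ volume (A + B) := by
  obtain ⟨x, hx⟩ := hA'
  obtain ⟨y, hy⟩ := hB'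
  have key : ∀ K ⊆ A, IsCompact K → ∀ L ⊆ B, IsCompact L →
      volume K + volume L ≤ volume (A + B) := by
    intro K hK hKc L hL hLc
    refine (add_le_add (measure_mono (Set.subset_insert x K))
      (measure_mono (Set.subset_insert y L))).trans <|
      (Real.volume_add_le_of_isCompact (hKc.insert x) (hLc.insert y) (by simp) (by simp)).trans ?_
    exact measure_mono (Set.add_subset_add (Set.insert_subset hx hK) (Set.insert_subset hy hL))
  rw [hA.measure_eq_iSup_isCompact, hB.measure_eq_iSup_isCompact]
  simp only [iSup_and']
  refine ENNReal.iSup_add_iSup_le ?_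
  intro K L
  by_cases hK : K ⊆ A ∧ IsCompact K <;> by_cases hL : L ⊆ B ∧ IsCompact L
  · simpa [hK, hL] using key K hK.1 hK.2 L hL.1 hL.2
  · simpa [hK, hL] using key K hK.1 hK.2 ∅ (by simp) isCompact_empty
  · simpa [hK, hL] using key ∅ (by simp) isCompact_empty L hL.1 hL.2
  · simp [hK, hL]

theorem lintegral_add_le_of_sup_eq_one {f g h : ℝ → ℝ} {a b : ℝ} (ha : 0 < a) (hb : 0 < b)
    (hf : Measurable f) (hg : Measurable g) (hh : Measurable h)
    (hf0 : 0 ≤ f) (hg0 : 0 ≤ g) (hh0 : 0 ≤ h) (hf1 : f ≤ 1) (hg1 : g ≤ 1)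
    (hfs : ∀ t < 1, ∃ x, t < f x) (hgs : ∀ t < 1, ∃ x, t < g x)
    (H : ∀ x y t, 0 ≤ t → t < f x → t < g y → t < h (a * x + b * y)) :
    ENNReal.ofReal a * (∫⁻ x, ENNReal.ofReal (f x)) +
      ENNReal.ofReal b * (∫⁻ x, ENNReal.ofReal (g x)) ≤ ∫⁻ x, ENNReal.ofReal (h x) := by
  rw [lintegral_eq_lintegral_meas_lt _ (.of_forall hf0) hf.aemeasurable,
    lintegral_eq_lintegral_meas_lt _ (.of_forall hg0) hg.aemeasurable,
    lintegral_eq_lintegral_meas_lt _ (.of_forall hh0) hh.aemeasurable]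
  have mf : ∀ f : ℝ → ℝ, Measurable fun t : ℝ => volume {x | t < f x} := fun f =>
    Antitone.measurable fun s t hst => measure_mono fun x hx => lt_of_le_of_lt hst hx
  rw [← lintegral_const_mul _ (mf f), ← lintegral_const_mul _ (mf g),
    ← lintegral_add_left ((mf f).const_mul _)]
  refine setLIntegral_mono (mf h) ?_
  intro t ht
  rcases lt_or_ge t 1 with ht1 | ht1
  · have e1 : volume (a • {x | t < f x}) = ENNReal.ofReal a * volume {x | t < f x} := by
      simp [Measure.addHaar_smul, abs_of_pos ha]
    have e2 : volume (b • {x | t < g x}) = ENNReal.ofReal b * volume {x | t < g x} := by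
      simp [Measure.addHaar_smul, abs_of_pos hb]
    rw [← e1, ← e2]
    refine (Real.volume_add_le ?_ ?_ ?_ ?_).trans (measure_mono ?_)
    · exact (measurableSet_lt measurable_const hf).const_smul_of_ne_zero ha.ne'
    · exact (measurableSet_lt measurable_const hg).const_smul_of_ne_zero hb.ne'
    · exact Set.Nonempty.smul_set (hfs t ht1)
    · exact Set.Nonempty.smul_set (hgs t ht1)
    · rintro _ ⟨_, ⟨x, hx, rfl⟩, _, ⟨y, hy, rfl⟩, rfl⟩
      exact H x y t (le_of_lt ht) hx hy
  · have e1 : {x | t < f x} = ∅ := by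
      ext x; simpa using (hf1 x).trans ht1
    have e2 : {x | t < g x} = ∅ := by
      ext x; simpa using (hg1 x).trans ht1
    simp [e1, e2]

/-- One-dimensional Prékopa–Leindler inequality for bounded functions. -/
theorem prekopa_leindler_real {f g h : ℝ → ℝ} {a b : ℝ} (ha : 0 < a) (hb : 0 < b) (hab : a + b = 1)
    (hf : Measurable f) (hg : Measurable g) (hh : Measurable h)
    (hf0 : 0 ≤ f) (hg0 : 0 ≤ g) (hh0 : 0 ≤ h)
    (hfb : BddAbove (Set.range f)) (hgb : BddAbove (Set.range g))
    (hfi : Integrable f) (hgi : Integrable g) (hhi : Integrable h)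
    (H : ∀ x y, f x ^ a * g y ^ b ≤ h (a * x + b * y)) :
    (∫ x, f x) ^ a * (∫ x, g x) ^ b ≤ ∫ x, h x := by
  set F := ⨆ x, f x with hF
  set G := ⨆ x, g x with hG
  have hfF : ∀ x, f x ≤ F := le_ciSup hfb
  have hgG : ∀ x, g x ≤ G := le_ciSup hgb
  have hF0 : 0 ≤ F := (hf0 0).trans (hfF 0)
  have hG0 : 0 ≤ G := (hg0 0).trans (hgG 0)
  have hI : 0 ≤ ∫ x, h x := integral_nonneg hh0
  rcases hF0.eq_or_lt with hFz | hFp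
  · have : f = 0 := by
      ext x; exact le_antisymm (by simpa [← hFz] using hfF x) (hf0 x)
    simpa [this, Real.zero_rpow ha.ne'] using hI
  rcases hG0.eq_or_lt with hGz | hGp
  · have : g = 0 := by
      ext x; exact le_antisymm (by simpa [← hGz] using hgG x) (hg0 x)
    simpa [this, Real.zero_rpow hb.ne'] using hI
  set M := F ^ a * G ^ b with hM
  have hMp : 0 < M := by positivity
  have key := lintegral_add_le_of_sup_eq_one (f := fun x => f x / F) (g := fun x => g x / G)
    (h := fun x => h x / M) ha hb (hf.div_const _) (hg.div_const _) (hh.div_const _)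
    (fun x => div_nonneg (hf0 x) hF0) (fun x => div_nonneg (hg0 x) hG0)
    (fun x => div_nonneg (hh0 x) hMp.le)
    (fun x => by simpa using div_le_one_of_le₀ (hfF x) hF0)
    (fun x => by simpa using div_le_one_of_le₀ (hgG x) hG0)
    (fun t ht => by
      obtain ⟨x, hx⟩ := exists_lt_of_lt_ciSup (show t * F < ⨆ x, f x by
        rw [← hF]; nlinarith)
      exact ⟨x, by rwa [lt_div_iff₀ hFp]⟩)
    (fun t ht => by
      obtain ⟨x, hx⟩ := exists_lt_of_lt_ciSup (show t * G < ⨆ x, g x by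
        rw [← hG]; nlinarith)
      exact ⟨x, by rwa [lt_div_iff₀ hGp]⟩)
    (by
      intro x y t ht hx hy
      have h1 : f x ^ a * g y ^ b / M = (f x / F) ^ a * (g y / G) ^ b := by
        rw [Real.div_rpow (hf0 x) hF0, Real.div_rpow (hg0 y) hG0, hM]; field_simp
      refine lt_of_lt_of_le ?_ (div_le_div_of_nonneg_right (H x y) hMp.le)
      rw [h1]
      calc t = t ^ a * t ^ b := by
            rcases ht.eq_or_lt with rfl | ht
            · simp [Real.zero_rpow ha.ne']
            · rw [← Real.rpow_add ht, hab, Real.rpow_one]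
        _ < _ := by
            have h2 := Real.rpow_lt_rpow ht hx ha
            have h3 := Real.rpow_lt_rpow ht hy hb
            exact mul_lt_mul'' h2 h3 (by positivity) (by positivity))
  rw [← ofReal_integral_eq_lintegral_ofReal (hfi.div_const _)
      (.of_forall fun x => div_nonneg (hf0 x) hF0),
    ← ofReal_integral_eq_lintegral_ofReal (hgi.div_const _)
      (.of_forall fun x => div_nonneg (hg0 x) hG0),
    ← ofReal_integral_eq_lintegral_ofReal (hhi.div_const _)
      (.of_forall fun x => div_nonneg (hh0 x) hMp.le),
    integral_div, integral_div, integral_div,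
    ← ENNReal.ofReal_mul ha.le, ← ENNReal.ofReal_mul hb.le] at key
  have If : 0 ≤ ∫ x, f x := integral_nonneg hf0
  have Ig : 0 ≤ ∫ x, g x := integral_nonneg hg0
  rw [← ENNReal.ofReal_add (by positivity) (by positivity),
    ENNReal.ofReal_le_ofReal_iff (by positivity)] at key
  have amgm := Real.geom_mean_le_arith_mean2_weighted ha.le hb.le
    (div_nonneg If hF0) (div_nonneg Ig hG0) hab
  have h4 := amgm.trans key
  rw [Real.div_rpow If hF0, Real.div_rpow Ig hG0, div_mul_div_comm, ← hM,
    div_le_div_iff_of_pos_right hMp] at h4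
  exact h4

/-- The multiplicative form of the Brunn–Minkowski inequality for compact sets. -/
def BrunnMinkowskiMul {E : Type*} [NormedAddCommGroup E] [NormedSpace ℝ E] [MeasurableSpace E]
    (μ : Measure E) : Prop :=
  ∀ A B : Set E, IsCompact A → IsCompact B → ∀ a b : ℝ, 0 < a → 0 < b → a + b = 1 →
    μ.real A ^ a * μ.real B ^ b ≤ μ.real (a • A + b • B)

theorem brunnMinkowskiMul_of_subsingleton {E : Type*} [NormedAddCommGroup E] [NormedSpace ℝ E]
    [MeasurableSpace E] (μ : Measure E) [Subsingleton E] : BrunnMinkowskiMul μ := by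
  intro A B hA hB a b ha hb hab
  rcases A.eq_empty_or_nonempty with rfl | hA'
  · simp [Real.zero_rpow ha.ne']
  rcases B.eq_empty_or_nonempty with rfl | hB'
  · simp [Real.zero_rpow hb.ne']
  have h1 : A = Set.univ := Subsingleton.eq_univ_of_nonempty hA'
  have h2 : B = Set.univ := Subsingleton.eq_univ_of_nonempty hB'
  have h3 : a • A + b • B = Set.univ :=
    Subsingleton.eq_univ_of_nonempty ((hA'.smul_set).add hB'.smul_set)
  rw [h3, h1, h2]
  rcases (measureReal_nonneg (μ := μ) (s := Set.univ)).eq_or_lt with h | h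
  · rw [← h]; simp [Real.zero_rpow ha.ne']
  · rw [← Real.rpow_add h, hab, Real.rpow_one]

section Slices

variable {W : Type*} [NormedAddCommGroup W] [NormedSpace ℝ W] [FiniteDimensional ℝ W]
  [MeasurableSpace W] [BorelSpace W] (ν : Measure W) [ν.IsAddHaarMeasure]

theorem IsCompact.slice {X Y : Type*} [TopologicalSpace X] [TopologicalSpace Y] [T2Space X]
    {A : Set (X × Y)} (hA : IsCompact A) (x : X) : IsCompact (Prod.mk x ⁻¹' A) := by
  have : Prod.mk x ⁻¹' A = Prod.snd '' (A ∩ Prod.fst ⁻¹' {x}) := by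
    ext y
    constructor
    · intro h
      exact ⟨(x, y), ⟨h, rfl⟩, rfl⟩
    · rintro ⟨⟨x', y'⟩, ⟨h, rfl⟩, rfl⟩
      exact h
  rw [this]
  exact (hA.inter_right (isClosed_singleton.preimage continuous_fst)).image continuous_snd

theorem measurable_measureReal_slice {A : Set (ℝ × W)} (hA : IsCompact A) :
    Measurable fun x => ν.real (Prod.mk x ⁻¹' A) :=
  (measurable_measure_prodMk_left hA.measurableSet).ennreal_toReal

theorem lintegral_slice_ne_top {A : Set (ℝ × W)} (hA : IsCompact A) :
    ∫⁻ x, ν (Prod.mk x ⁻¹' A) ≠ ⊤ := by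
  rw [← Measure.prod_apply hA.measurableSet]
  exact hA.measure_lt_top.ne

theorem integrable_measureReal_slice {A : Set (ℝ × W)} (hA : IsCompact A) :
    Integrable fun x => ν.real (Prod.mk x ⁻¹' A) :=
  integrable_toReal_of_lintegral_ne_top
    (measurable_measure_prodMk_left hA.measurableSet).aemeasurable (lintegral_slice_ne_top ν hA)

theorem measureReal_prod_eq_integral_slice {A : Set (ℝ × W)} (hA : IsCompact A) :
    ((volume : Measure ℝ).prod ν).real A = ∫ x, ν.real (Prod.mk x ⁻¹' A) := by
  simp only [Measure.real]
  rw [integral_toReal (measurable_measure_prodMk_left hA.measurableSet).aemeasurable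
    (.of_forall fun x => (hA.slice x).measure_lt_top), Measure.prod_apply hA.measurableSet]

omit [NormedSpace ℝ W] [FiniteDimensional ℝ W] [BorelSpace W] in
theorem measureReal_slice_le {A : Set (ℝ × W)} (hA : IsCompact A) (x : ℝ) :
    ν.real (Prod.mk x ⁻¹' A) ≤ ν.real (Prod.snd '' A) :=
  measureReal_mono (fun y hy => ⟨(x, y), hy, rfl⟩)
    (hA.image continuous_snd).measure_lt_top.ne

theorem BrunnMinkowskiMul.prod {ν : Measure W} [ν.IsAddHaarMeasure] (h : BrunnMinkowskiMul ν) :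
    BrunnMinkowskiMul ((volume : Measure ℝ).prod ν) := by
  intro A B hA hB a b ha hb hab
  have hC : IsCompact (a • A + b • B) := (hA.smul a).add (hB.smul b)
  rw [measureReal_prod_eq_integral_slice ν hA, measureReal_prod_eq_integral_slice ν hB,
    measureReal_prod_eq_integral_slice ν hC]
  refine prekopa_leindler_real ha hb hab (measurable_measureReal_slice ν hA)
    (measurable_measureReal_slice ν hB) (measurable_measureReal_slice ν hC)
    (fun _ => measureReal_nonneg) (fun _ => measureReal_nonneg) (fun _ => measureReal_nonneg)
    ⟨_, Set.forall_mem_range.2 (measureReal_slice_le ν hA)⟩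
    ⟨_, Set.forall_mem_range.2 (measureReal_slice_le ν hB)⟩
    (integrable_measureReal_slice ν hA) (integrable_measureReal_slice ν hB)
    (integrable_measureReal_slice ν hC) ?_
  intro x y
  refine (h _ _ (hA.slice x) (hB.slice y) a b ha hb hab).trans ?_
  refine measureReal_mono ?_ (hC.slice _).measure_lt_top.ne
  rintro _ ⟨_, ⟨u, hu, rfl⟩, _, ⟨v, hv, rfl⟩, rfl⟩
  exact ⟨_, ⟨_, hu, rfl⟩, _, ⟨_, hv, rfl⟩, by simp⟩

end Slices

/-- Linear isomorphisms multiply Haar measure by a constant. -/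
theorem exists_measureReal_eq_mul_image {E F : Type*} [NormedAddCommGroup E] [NormedSpace ℝ E]
    [FiniteDimensional ℝ E] [MeasurableSpace E] [BorelSpace E]
    [NormedAddCommGroup F] [NormedSpace ℝ F] [MeasurableSpace F]
    [BorelSpace F] (μ : Measure E) [μ.IsAddHaarMeasure] (ν : Measure F) [ν.IsAddHaarMeasure]
    (e : E ≃L[ℝ] F) : ∃ c : ℝ, 0 < c ∧ ∀ A : Set E, μ.real A = c * ν.real (e '' A) := by
  have : FiniteDimensional ℝ F := e.toLinearEquiv.finiteDimensional
  have : (Measure.map e μ).IsAddHaarMeasure := e.isAddHaarMeasure_map μ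
  have h1 := Measure.isAddLeftInvariant_eq_smul (Measure.map e μ) ν
  refine ⟨Measure.addHaarScalarFactor (Measure.map e μ) ν,
    Measure.addHaarScalarFactor_pos_of_isAddHaarMeasure _ _, fun A => ?_⟩
  have h2 : Measure.map e μ (e '' A) = μ A := by
    have := e.toHomeomorph.toMeasurableEquiv.map_apply (μ := μ) (e '' A)
    simp only [Homeomorph.toMeasurableEquiv_coe, ContinuousLinearEquiv.coe_toHomeomorph] at this
    rw [this, Set.preimage_image_eq _ e.injective]
  have h3 := congrArg (fun m => (m (e '' A)).toReal) h1
  rw [h2] at h3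
  rw [Measure.real, h3]
  simp [Measure.real]

theorem BrunnMinkowskiMul.transfer {E F : Type*} [NormedAddCommGroup E] [NormedSpace ℝ E]
    [FiniteDimensional ℝ E] [MeasurableSpace E] [BorelSpace E]
    [NormedAddCommGroup F] [NormedSpace ℝ F] [MeasurableSpace F]
    [BorelSpace F] {μ : Measure E} [μ.IsAddHaarMeasure] {ν : Measure F} [ν.IsAddHaarMeasure]
    (h : BrunnMinkowskiMul ν) (e : E ≃L[ℝ] F) : BrunnMinkowskiMul μ := by
  obtain ⟨c, hc, key⟩ := exists_measureReal_eq_mul_image μ ν e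
  intro A B hA hB a b ha hb hab
  rw [key, key, key, Real.mul_rpow (by positivity) (by positivity),
    Real.mul_rpow (by positivity) (by positivity)]
  have h3 := h _ _ (hA.image e.continuous) (hB.image e.continuous) a b ha hb hab
  have h4 : e '' (a • A + b • B) = a • (e '' A) + b • (e '' B) := by
    rw [Set.image_add, image_smul_set, image_smul_set]
  have h5 : c ^ a * c ^ b = c := by rw [← Real.rpow_add hc, hab, Real.rpow_one]
  rw [h4]
  calc _ = (c ^ a * c ^ b) * (ν.real (e '' A) ^ a * ν.real (e '' B) ^ b) := by ring
    _ ≤ _ := by rw [h5]; gcongr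

theorem brunnMinkowskiMul_pi (n : ℕ) : BrunnMinkowskiMul (volume : Measure (Fin n → ℝ)) := by
  induction n with
  | zero => exact brunnMinkowskiMul_of_subsingleton _
  | succ n ih =>
    exact ih.prod.transfer (ContinuousLinearEquiv.ofFinrankEq (by simp [add_comm]))

section HaarMeasure

variable {E : Type*} [NormedAddCommGroup E] [NormedSpace ℝ E]
  [FiniteDimensional ℝ E] [MeasurableSpace E] [BorelSpace E] (μ : Measure E) [μ.IsAddHaarMeasure]

theorem brunnMinkowskiMul : BrunnMinkowskiMul μ :=
  (brunnMinkowskiMul_pi (Module.finrank ℝ E)).transfer (ContinuousLinearEquiv.ofFinrankEq (by simp))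

open Module

theorem measureReal_smul_of_nonneg (A : Set E) {c : ℝ} (hc : 0 ≤ c) :
    μ.real (c • A) = c ^ finrank ℝ E * μ.real A := by
  rw [Measure.real, Measure.addHaar_smul, ENNReal.toReal_mul, abs_of_nonneg (by positivity),
    ENNReal.toReal_ofReal (by positivity)]
  rfl

/-- The Brunn–Minkowski inequality for compact sets. -/
theorem brunn_minkowski [Nontrivial E] {A B : Set E} (hA : IsCompact A) (hB : IsCompact B)
    (hA' : A.Nonempty) (hB' : B.Nonempty) :
    μ.real A ^ (finrank ℝ E : ℝ)⁻¹ + μ.real B ^ (finrank ℝ E : ℝ)⁻¹ ≤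
      μ.real (A + B) ^ (finrank ℝ E : ℝ)⁻¹ := by
  set m := finrank ℝ E with hm
  have hm0 : m ≠ 0 := finrank_pos.ne'
  have hAB := (hA.add hB).measure_lt_top (μ := μ).ne
  set α := μ.real A ^ (m : ℝ)⁻¹
  set β := μ.real B ^ (m : ℝ)⁻¹
  have hα : 0 ≤ α := by positivity
  have hβ : 0 ≤ β := by positivity
  have eα : α ^ m = μ.real A := Real.rpow_inv_natCast_pow (by positivity) hm0
  have eβ : β ^ m = μ.real B := Real.rpow_inv_natCast_pow (by positivity) hm0
  have mono : ∀ S : Set E, μ.real S ≤ μ.real (A + B) →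
      μ.real S ^ (m : ℝ)⁻¹ ≤ μ.real (A + B) ^ (m : ℝ)⁻¹ := fun S h =>
    Real.rpow_le_rpow (by positivity) h (by positivity)
  rcases hα.eq_or_lt with h0 | hα
  · rw [← h0, zero_add]
    refine mono B ?_
    obtain ⟨x, hx⟩ := hA'
    have : μ.real B = μ.real ({x} + B) := by rw [Set.singleton_add]; simp [Measure.real]
    rw [this]
    exact measureReal_mono (Set.add_subset_add_right (by simpa using hx)) hAB
  rcases hβ.eq_or_lt with h0 | hβ
  · rw [← h0, add_zero]
    refine mono A ?_
    obtain ⟨x, hx⟩ := hB'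
    have : μ.real A = μ.real (A + {x}) := by
      rw [Set.add_singleton]; simp [Measure.real, measure_preimage_add_right]
    rw [this]
    exact measureReal_mono (Set.add_subset_add_left (by simpa using hx)) hAB
  set s := α + β with hs
  have hsp : 0 < s := by positivity
  have h1 := brunnMinkowskiMul μ (α⁻¹ • A) (β⁻¹ • B) (hA.smul _) (hB.smul _) (α / s) (β / s)
    (by positivity) (by positivity) (by rw [← add_div, div_self hsp.ne'])
  rw [measureReal_smul_of_nonneg μ A (by positivity), measureReal_smul_of_nonneg μ B (by positivity),
    ← hm, ← eα, ← eβ, ← mul_pow, ← mul_pow, inv_mul_cancel₀ hα.ne', inv_mul_cancel₀ hβ.ne',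
    smul_smul, smul_smul] at h1
  have e1 : α / s * α⁻¹ = s⁻¹ := by field_simp
  have e2 : β / s * β⁻¹ = s⁻¹ := by field_simp
  rw [e1, e2, ← smul_add, measureReal_smul_of_nonneg μ _ (by positivity), ← hm] at h1
  simp only [one_pow, Real.one_rpow, mul_one] at h1
  rw [inv_pow, ← div_eq_inv_mul, one_le_div (by positivity)] at h1
  calc s = (s ^ m) ^ (m : ℝ)⁻¹ := (Real.pow_rpow_inv_natCast hsp.le hm0).symm
    _ ≤ _ := Real.rpow_le_rpow (by positivity) h1 (by positivity)

end HaarMeasure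

section Derivative

open Module Topology Filter

variable {E : Type*} [NormedAddCommGroup E] [NormedSpace ℝ E]
  [FiniteDimensional ℝ E] [MeasurableSpace E] [BorelSpace E] (μ : Measure E) [μ.IsAddHaarMeasure]
  {A B : Set E}

omit [NormedSpace ℝ E] [FiniteDimensional ℝ E] in
theorem measureReal_add_singleton (A : Set E) (x : E) : μ.real (A + {x}) = μ.real A := by
  rw [Set.add_singleton]; simp [Measure.real, measure_preimage_add_right]

omit [NormedSpace ℝ E] [FiniteDimensional ℝ E] in
theorem measureReal_singleton_add (A : Set E) (x : E) : μ.real ({x} + A) = μ.real A := by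
  rw [add_comm, measureReal_add_singleton]

omit [NormedSpace ℝ E] [FiniteDimensional ℝ E] [BorelSpace E] in
theorem measureReal_pos_of_interior_nonempty (hA : IsCompact A) (iA : (interior A).Nonempty) :
    0 < μ.real A :=
  ENNReal.toReal_pos ((isOpen_interior.measure_pos μ iA).trans_le
    (measure_mono interior_subset)).ne' hA.measure_lt_top.ne

omit [FiniteDimensional ℝ E] [MeasurableSpace E] [BorelSpace E] in
theorem exists_subset_smul_add_singleton (iA : (interior A).Nonempty) (hB : IsCompact B) :
    ∃ C : ℝ, 0 ≤ C ∧ ∃ z : E, B ⊆ C • A + {z} := by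
  obtain ⟨x, hx⟩ := iA
  obtain ⟨ρ, hρ, hρA⟩ := Metric.isOpen_iff.1 isOpen_interior x hx
  obtain ⟨R, hR, hBR⟩ := hB.isBounded.subset_ball_lt 0 0
  refine ⟨R / ρ, by positivity, -((R / ρ) • x), fun y hy => ?_⟩
  refine ⟨(R / ρ) • (x + (R / ρ)⁻¹ • y), ⟨_, interior_subset (hρA ?_), rfl⟩, _, rfl, ?_⟩
  · have := hBR hy
    simp only [Metric.mem_ball, dist_eq_norm, sub_zero] at this ⊢
    rw [add_sub_cancel_left, norm_smul, Real.norm_of_nonneg (by positivity), inv_div, div_mul_eq_mul_div,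
      div_lt_iff₀ hR]
    gcongr
  · have : R / ρ * (ρ / R) = 1 := by field_simp
    simp [smul_add, smul_smul, this]

theorem exists_measureReal_smul_add_smul_le (hA : IsCompact A) (cA : Convex ℝ A)
    (iA : (interior A).Nonempty) (hB : IsCompact B) :
    ∃ C : ℝ, 0 ≤ C ∧ ∀ s t : ℝ, 0 ≤ s → 0 ≤ t →
      μ.real (s • A + t • B) ≤ (s + t * C) ^ finrank ℝ E * μ.real A := by
  obtain ⟨C, hC, z, hz⟩ := exists_subset_smul_add_singleton iA hB
  refine ⟨C, hC, fun s t hs ht => ?_⟩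
  rw [← measureReal_smul_of_nonneg μ A (by positivity),
    ← measureReal_add_singleton μ ((s + t * C) • A) (t • z)]
  refine measureReal_mono ?_ ((hA.smul _).add isCompact_singleton).measure_lt_top.ne
  rw [cA.add_smul hs (by positivity), mul_smul, add_assoc]
  refine Set.add_subset_add_left ?_
  rw [← Set.smul_set_singleton, ← smul_add]
  exact Set.smul_set_mono hz

/-- The one-sided derivative at `0` of `t ↦ vol (A + t B)` exists and satisfies Minkowski's first
inequality. -/
theorem exists_hasDerivWithinAt_measureReal_add_smul [Nontrivial E] (hA : IsCompact A)
    (cA : Convex ℝ A) (iA : (interior A).Nonempty) (hB : IsCompact B)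
    (hB' : B.Nonempty) :
    ∃ D : ℝ, HasDerivWithinAt (fun t : ℝ => μ.real (A + t • B)) D (Set.Ioi 0) 0 ∧
      finrank ℝ E * (μ.real A ^ (finrank ℝ E : ℝ)⁻¹) ^ (finrank ℝ E - 1) *
        μ.real B ^ (finrank ℝ E : ℝ)⁻¹ ≤ D := by
  set m := finrank ℝ E with hm
  have hm0 : m ≠ 0 := finrank_pos.ne'
  have hA' : A.Nonempty := iA.mono interior_subset
  set h : ℝ → ℝ := fun t => μ.real (A + t • B) ^ (m : ℝ)⁻¹ with hh
  have h0 : h 0 = μ.real A ^ (m : ℝ)⁻¹ := by simp [hh, Set.zero_smul_set hB']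
  have rt_smul : ∀ (c : ℝ) (S : Set E), 0 ≤ c →
      μ.real (c • S) ^ (m : ℝ)⁻¹ = c * μ.real S ^ (m : ℝ)⁻¹ := by
    intro c S hc
    rw [measureReal_smul_of_nonneg μ S hc, Real.mul_rpow (by positivity) (by positivity),
      Real.pow_rpow_inv_natCast hc hm0]
  have hcomp : ∀ t : ℝ, IsCompact (A + t • B) := fun t => hA.add (hB.smul t)
  have hlow : ∀ t, 0 ≤ t → h 0 + t * μ.real B ^ (m : ℝ)⁻¹ ≤ h t := by
    intro t ht
    rw [h0, ← rt_smul t B ht]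
    exact brunn_minkowski μ hA (hB.smul t) hA' hB'.smul_set
  obtain ⟨C, hC, hbd⟩ := exists_measureReal_smul_add_smul_le μ hA cA iA hB
  have hup : ∀ t, 0 ≤ t → h t ≤ (1 + t * C) * h 0 := by
    intro t ht
    have h1 := hbd 1 t zero_le_one ht
    rw [one_smul, ← hm] at h1
    rw [h0, ← Real.pow_rpow_inv_natCast (show 0 ≤ 1 + t * C by positivity) hm0,
      ← Real.mul_rpow (by positivity) (by positivity)]
    exact Real.rpow_le_rpow (by positivity) h1 (by positivity)
  have hconc : ∀ s t, 0 < s → s ≤ t → (h t - h 0) / t ≤ (h s - h 0) / s := by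
    intro s t hs hst
    have ht := hs.trans_le hst
    have e1 : A + s • B = (1 - s / t) • A + (s / t) • (A + t • B) := by
      have e3 : A = (1 - s / t) • A + (s / t) • A := by
        rw [← cA.add_smul (by rw [sub_nonneg]; exact div_le_one_of_le₀ hst ht.le) (by positivity)]
        simp
      conv_lhs => rw [e3]
      rw [smul_add, smul_smul, div_mul_cancel₀ _ ht.ne', add_assoc]
    have h1 : (1 - s / t) * h 0 + (s / t) * h t ≤ h s := by
      rw [h0, hh, ← rt_smul _ _ (by rw [sub_nonneg]; exact div_le_one_of_le₀ hst ht.le),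
        ← rt_smul _ _ (by positivity)]
      simp only
      rw [e1]
      exact brunn_minkowski μ (hA.smul _) ((hcomp t).smul _) hA'.smul_set
        (hA'.add hB'.smul_set).smul_set
    rw [le_div_iff₀ hs]
    have : (h t - h 0) / t * s = (s / t) * h t - (s / t) * h 0 := by field_simp
    rw [this]; linarith
  have hbdd : BddAbove ((fun t => (h t - h 0) / t) '' Set.Ioo 0 1) := by
    refine ⟨C * h 0, ?_⟩
    rintro _ ⟨t, ht, rfl⟩
    dsimp only
    rw [div_le_iff₀ ht.1]
    linarith [hup t ht.1.le]
  have hanti : AntitoneOn (fun t => (h t - h 0) / t) (Set.Ioo 0 1) :=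
    fun s hs t _ hst => hconc s t hs.1 hst
  have hlim := hanti.tendsto_nhdsWithin_Ioo_right ⟨1 / 2, by norm_num, by norm_num⟩ hbdd
  set d := sSup ((fun t => (h t - h 0) / t) '' Set.Ioo 0 1)
  have hd : μ.real B ^ (m : ℝ)⁻¹ ≤ d := by
    refine ge_of_tendsto hlim ?_
    filter_upwards [self_mem_nhdsWithin] with t (ht : 0 < t)
    rw [le_div_iff₀ ht]
    linarith [hlow t ht.le]
  have hder : HasDerivWithinAt h d (Set.Ioi 0) 0 := by
    rw [hasDerivWithinAt_iff_tendsto_slope' (by simp)]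
    refine hlim.congr fun t => ?_
    simp [slope_def_field]
  have hpow := hder.pow m
  have hfun : (h ^ m) = fun t : ℝ => μ.real (A + t • B) := by
    ext t
    exact Real.rpow_inv_natCast_pow (by positivity) hm0
  rw [hfun] at hpow
  refine ⟨_, hpow, ?_⟩
  rw [h0]
  gcongr

end Derivative

section AltSum

open fwdDiff

/-- The `k`-th finite difference of `q` at `0`. -/
noncomputable def altSum (k : ℕ) (q : ℕ → ℝ) : ℝ :=
  ∑ c ∈ Finset.range (k + 1), (-1) ^ (k - c) * (k.choose c : ℝ) * q c

theorem altSum_eq_fwdDiff_iterate (k : ℕ) (q : ℕ → ℝ) : altSum k q = (fwdDiff 1)^[k] q 0 := by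
  rw [fwdDiff_iter_eq_sum_shift, altSum]
  simp

theorem altSum_succ (k : ℕ) (q : ℕ → ℝ) :
    altSum (k + 1) q = altSum k fun c => q (c + 1) - q c := by
  rw [altSum_eq_fwdDiff_iterate, altSum_eq_fwdDiff_iterate, Function.iterate_succ_apply]
  rfl

theorem altSum_pow (k : ℕ) : altSum k (fun c => (c : ℝ) ^ k) = k.factorial := by
  have h := congrFun (fwdDiff_iter_eq_factorial (R := ℝ) (n := k)) 0
  rw [fwdDiff_iter_eq_sum_shift] at h
  simpa [altSum] using h

theorem altSum_add (k : ℕ) (p q : ℕ → ℝ) :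
    altSum k (fun c => p c + q c) = altSum k p + altSum k q := by
  simp [altSum, mul_add, Finset.sum_add_distrib]

theorem altSum_const_mul (k : ℕ) (a : ℝ) (q : ℕ → ℝ) :
    altSum k (fun c => a * q c) = a * altSum k q := by
  simp only [altSum, Finset.mul_sum]
  exact Finset.sum_congr rfl fun _ _ => by ring

theorem Filter.Tendsto.altSum {ι : Type*} {l : Filter ι} (k : ℕ) {q : ι → ℕ → ℝ} {p : ℕ → ℝ}
    (h : ∀ c, Tendsto (fun i => q i c) l (nhds (p c))) :
    Tendsto (fun i => altSum k (q i)) l (nhds (altSum k p)) :=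
  tendsto_finsetSum _ fun c _ => (h c).const_mul _

end AltSum

section ConeSection

open Module Topology Filter

variable {W : Type*} [NormedAddCommGroup W] [NormedSpace ℝ W] {F S : Set W}

/-- The part between the levels `c` and `c + 1` of the set whose slice at level `x` is
`x • F + t • S`. -/
def coneSection (F S : Set W) (t c : ℝ) : Set (ℝ × W) :=
  {z | z.1 ∈ Set.Icc c (c + 1) ∧ z.2 ∈ z.1 • F + t • S}

theorem isCompact_coneSection (hF : IsCompact F) (hS : IsCompact S) (t c : ℝ) :
    IsCompact (coneSection F S t c) := by
  have h := ((isCompact_Icc (a := c) (b := c + 1)).prod (hF.prod hS)).image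
    (f := fun y : ℝ × W × W => (y.1, y.1 • y.2.1 + t • y.2.2)) (by fun_prop)
  convert h using 1
  ext ⟨x, w⟩
  constructor
  · rintro ⟨hx, _, ⟨f, hf, rfl⟩, _, ⟨s, hs, rfl⟩, h⟩
    exact ⟨(x, f, s), ⟨hx, hf, hs⟩, Prod.ext rfl h⟩
  · rintro ⟨⟨x', f, s⟩, ⟨hx, hf, hs⟩, h⟩
    simp only [Prod.mk.injEq] at h
    obtain ⟨rfl, rfl⟩ := h
    exact ⟨hx, Set.add_mem_add (Set.smul_mem_smul_set hf) (Set.smul_mem_smul_set hs)⟩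

variable [FiniteDimensional ℝ W] [MeasurableSpace W] [BorelSpace W]
  (ν : Measure W) [ν.IsAddHaarMeasure]

omit [FiniteDimensional ℝ W] [BorelSpace W] [ν.IsAddHaarMeasure] in
theorem measureReal_slice_coneSection (F S : Set W) (t c : ℝ) :
    (fun x => ν.real (Prod.mk x ⁻¹' coneSection F S t c)) =
      (Set.Icc c (c + 1)).indicator fun x => ν.real (x • F + t • S) := by
  ext x
  by_cases hx : x ∈ Set.Icc c (c + 1)
  · rw [Set.indicator_of_mem hx]
    congr 1
    ext w
    simp only [coneSection, Set.mem_preimage, Set.mem_ofPred_eq, hx, true_and]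
  · rw [Set.indicator_of_notMem hx]
    have : Prod.mk x ⁻¹' coneSection F S t c = ∅ := by
      ext w
      simp only [coneSection, Set.mem_preimage, Set.mem_ofPred_eq, hx, false_and,
        Set.mem_empty_iff_false]
    simp [this]

theorem measureReal_coneSection (hF : IsCompact F) (hS : IsCompact S) (t c : ℝ) :
    ((volume : Measure ℝ).prod ν).real (coneSection F S t c) =
      ∫ x in Set.Icc c (c + 1), ν.real (x • F + t • S) := by
  rw [measureReal_prod_eq_integral_slice ν (isCompact_coneSection hF hS t c),
    measureReal_slice_coneSection, integral_indicator measurableSet_Icc]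

theorem integrableOn_measureReal_smul_add_smul (hF : IsCompact F) (hS : IsCompact S) (t c : ℝ) :
    IntegrableOn (fun x => ν.real (x • F + t • S)) (Set.Icc c (c + 1)) := by
  rw [← integrable_indicator_iff measurableSet_Icc, ← measureReal_slice_coneSection]
  exact integrable_measureReal_slice ν (isCompact_coneSection hF hS t c)

theorem setIntegral_Icc_pow (c : ℝ) (k : ℕ) :
    ∫ x in Set.Icc c (c + 1), x ^ k = ((c + 1) ^ (k + 1) - c ^ (k + 1)) / (k + 1) := by
  rw [integral_Icc_eq_integral_Ioc, ← intervalIntegral.integral_of_le (by linarith), integral_pow]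

theorem measureReal_coneSection_zero (hF : IsCompact F) (hS : IsCompact S) (hS' : S.Nonempty)
    {c : ℝ} (hc : 0 ≤ c) :
    ((volume : Measure ℝ).prod ν).real (coneSection F S 0 c) =
      ν.real F * (((c + 1) ^ (finrank ℝ W + 1) - c ^ (finrank ℝ W + 1)) / (finrank ℝ W + 1)) := by
  rw [measureReal_coneSection ν hF hS, ← setIntegral_Icc_pow, ← integral_const_mul]
  refine setIntegral_congr_fun measurableSet_Icc fun x hx => ?_
  rw [Set.zero_smul_set hS', add_zero, measureReal_smul_of_nonneg ν _ (hc.trans hx.1), mul_comm]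

theorem tendsto_measureReal_smul_add_smul {g : ℝ}
    (hg : HasDerivWithinAt (fun t : ℝ => ν.real (F + t • S)) g (Set.Ioi 0) 0) (hS' : S.Nonempty)
    {m : ℕ} (hm : finrank ℝ W = m + 1) {x : ℝ} (hx : 0 < x) :
    Tendsto (fun t => (ν.real (x • F + t • S) - ν.real (x • F)) / t) (𝓝[>] 0)
      (𝓝 (x ^ m * g)) := by
  rw [hasDerivWithinAt_iff_tendsto_slope' (by simp)] at hg
  have h1 : Tendsto (fun t : ℝ => x⁻¹ * t) (𝓝[>] 0) (𝓝[>] 0) := by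
    refine tendsto_nhdsWithin_of_tendsto_nhds_of_eventually_within _ ?_ ?_
    · have : Tendsto (fun t : ℝ => x⁻¹ * t) (𝓝 0) (𝓝 (x⁻¹ * 0)) :=
        tendsto_id.const_mul _
      rw [mul_zero] at this
      exact this.mono_left nhdsWithin_le_nhds
    · filter_upwards [self_mem_nhdsWithin] with t ht
      exact mul_pos (inv_pos.2 hx) ht
  refine ((hg.comp h1).const_mul (x ^ m)).congr' ?_
  filter_upwards [self_mem_nhdsWithin] with t (ht : 0 < t)
  have e1 : x • F + t • S = x • (F + (x⁻¹ * t) • S) := by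
    rw [smul_add, smul_smul, mul_inv_cancel_left₀ hx.ne']
  rw [e1, measureReal_smul_of_nonneg ν _ hx.le, measureReal_smul_of_nonneg ν _ hx.le, hm]
  simp only [Function.comp, slope_def_field, Set.zero_smul_set hS', add_zero, sub_zero]
  field_simp
  ring

theorem tendsto_measureReal_coneSection (hF : IsCompact F) (cF : Convex ℝ F)
    (iF : (interior F).Nonempty) (hS : IsCompact S) (hS' : S.Nonempty) {g : ℝ}
    (hg : HasDerivWithinAt (fun t : ℝ => ν.real (F + t • S)) g (Set.Ioi 0) 0)
    {m : ℕ} (hm : finrank ℝ W = m + 1) {c : ℝ} (hc : 0 ≤ c) :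
    Tendsto (fun t => (((volume : Measure ℝ).prod ν).real (coneSection F S t c) -
        ((volume : Measure ℝ).prod ν).real (coneSection F S 0 c)) / t) (𝓝[>] 0)
      (𝓝 (g * (((c + 1) ^ (m + 1) - c ^ (m + 1)) / (m + 1)))) := by
  obtain ⟨C, hC, hbd⟩ := exists_measureReal_smul_add_smul_le ν hF cF iF hS
  obtain ⟨s₀, hs₀⟩ := hS'
  have hlim : g * (((c + 1) ^ (m + 1) - c ^ (m + 1)) / (m + 1)) =
      ∫ x in Set.Icc c (c + 1), x ^ m * g := by
    rw [integral_mul_const, setIntegral_Icc_pow, mul_comm]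
  have hfun : ∀ t, (((volume : Measure ℝ).prod ν).real (coneSection F S t c) -
        ((volume : Measure ℝ).prod ν).real (coneSection F S 0 c)) / t =
      ∫ x in Set.Icc c (c + 1), (ν.real (x • F + t • S) - ν.real (x • F)) / t := by
    intro t
    have := integrableOn_measureReal_smul_add_smul ν hF hS 0 c
    rw [measureReal_coneSection ν hF hS, measureReal_coneSection ν hF hS, integral_div,
      integral_sub (integrableOn_measureReal_smul_add_smul ν hF hS t c)]
    · simp [Set.zero_smul_set ⟨s₀, hs₀⟩]
    · simp only [Set.zero_smul_set ⟨s₀, hs₀⟩, add_zero] at this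
      exact this
  rw [hlim]
  simp only [hfun]
  have hInt : ∀ t, IntegrableOn (fun x => (ν.real (x • F + t • S) - ν.real (x • F)) / t)
      (Set.Icc c (c + 1)) := by
    intro t
    have := integrableOn_measureReal_smul_add_smul ν hF hS 0 c
    simp only [Set.zero_smul_set ⟨s₀, hs₀⟩, add_zero] at this
    exact ((integrableOn_measureReal_smul_add_smul ν hF hS t c).sub this).div_const t
  refine tendsto_integral_filter_of_dominated_convergence
    (fun _ => (c + 1 + C) ^ (m + 1) * ν.real F) ?_ ?_ ?_ ?_
  · exact .of_forall fun t => (hInt t).aestronglyMeasurable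
  · filter_upwards [Ioo_mem_nhdsGT (zero_lt_one' ℝ)] with t ht
    refine (ae_restrict_iff' measurableSet_Icc).2 (.of_forall fun x hx => ?_)
    have hx0 : 0 ≤ x := hc.trans hx.1
    have h1 := hbd x t hx0 ht.1.le
    have h2 : ν.real (x • F) ≤ ν.real (x • F + t • S) := by
      rw [← measureReal_add_singleton ν (x • F) (t • s₀)]
      refine measureReal_mono (Set.add_subset_add_left ?_)
        ((hF.smul x).add (hS.smul t)).measure_lt_top.ne
      simpa using Set.smul_mem_smul_set hs₀
    rw [Real.norm_of_nonneg (div_nonneg (sub_nonneg.2 h2) ht.1.le), div_le_iff₀ ht.1]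
    rw [measureReal_smul_of_nonneg ν _ hx0]
    rw [hm] at h1 ⊢
    have h3 := (convexOn_pow (m + 1)).2 (Set.mem_Ici.2 hx0)
      (Set.mem_Ici.2 (add_nonneg hx0 hC)) (sub_nonneg.2 ht.2.le) ht.1.le (by ring)
    simp only [smul_eq_mul] at h3
    have e1 : (1 - t) * x + t * (x + C) = x + t * C := by ring
    rw [e1] at h3
    have h4 : (x + C) ^ (m + 1) ≤ (c + 1 + C) ^ (m + 1) := by
      have := hx.2
      gcongr
    have hb : 0 ≤ ν.real F := measureReal_nonneg
    have hx2 : 0 ≤ x ^ (m + 1) := by positivity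
    have h5 : (x + t * C) ^ (m + 1) - x ^ (m + 1) ≤ t * (c + 1 + C) ^ (m + 1) := by
      nlinarith [ht.1, mul_le_mul_of_nonneg_left h4 ht.1.le, mul_nonneg ht.1.le hx2]
    nlinarith [mul_le_mul_of_nonneg_right h5 hb]
  · exact integrable_const _
  · refine (ae_restrict_iff' measurableSet_Icc).2 ?_
    filter_upwards [
      (measure_eq_zero_iff_ae_notMem (μ := volume) (s := {(0 : ℝ)})).1 (by simp)] with x hx0 hx
    exact tendsto_measureReal_smul_add_smul ν hg ⟨s₀, hs₀⟩ hm
      (lt_of_le_of_ne (hc.trans hx.1) fun h => hx0 h.symm)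

end ConeSection

section Truncation

open Module Topology Filter

variable {W : Type*} [NormedAddCommGroup W] [NormedSpace ℝ W] {Q Δ : Set (ℝ × W)} {S : Set W}

theorem snd_mem_smul_slice (cQ : Convex ℝ Q) (h0 : 0 ∈ Q) (hΔ : Δ = Q ∩ {z | 1 ≤ z.1})
    (hF : (Prod.mk 1 ⁻¹' Δ).Nonempty) {r : ℝ} {z : ℝ × W} (hr : 0 ≤ r) (hrz : r ≤ z.1)
    (hz : z ∈ r • Q) : z.2 ∈ z.1 • (Prod.mk 1 ⁻¹' Δ) := by
  obtain ⟨q, hq, rfl⟩ := hz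
  simp only at hrz ⊢
  rcases (hr.trans hrz).eq_or_lt with h | h
  · have hr0 : r = 0 := le_antisymm (hrz.trans h.symm.le) hr
    simp [hr0, Set.zero_smul_set hF]
  · refine ⟨(r • q).1⁻¹ • (r • q).2, ?_, by simp only [smul_smul, mul_inv_cancel₀ h.ne', one_smul]⟩
    rw [hΔ]
    refine ⟨?_, le_refl (1 : ℝ)⟩
    have := cQ.smul_mem_of_zero_mem h0 hq (t := (r • q).1⁻¹ * r)
      ⟨by positivity, by rw [inv_mul_le_iff₀ h, mul_one]; exact hrz⟩
    convert this using 1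
    refine Prod.ext ?_ ?_
    · have h' := h.ne'
      simp only [Prod.smul_fst, smul_eq_mul] at h' ⊢
      rw [mul_assoc]
      exact (inv_mul_cancel₀ h').symm
    · simp [smul_smul]

theorem smul_add_smul_slice_subset {c x : ℝ}
    (hx : x ∈ Set.Icc c (c + 1)) {w : W} (hw : w ∈ x • (Prod.mk 1 ⁻¹' Δ)) :
    (x, w) ∈ Set.Icc (0 : ℝ) 1 • Δ + c • Δ := by
  obtain ⟨f, hf, rfl⟩ := hw
  refine ⟨(x - c) • ((1 : ℝ), f), Set.smul_mem_smul ⟨by linarith [hx.1], by linarith [hx.2]⟩ hf,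
    c • ((1 : ℝ), f), Set.smul_mem_smul_set hf, ?_⟩
  simp [← add_smul]

theorem smul_add_Icc_smul_add_smul_eq (cQ : Convex ℝ Q) (h0 : 0 ∈ Q)
    (hΔ : Δ = Q ∩ {z | 1 ≤ z.1}) (hF : (Prod.mk 1 ⁻¹' Δ).Nonempty) {c : ℝ} (hc : 0 ≤ c) (t : ℝ) :
    t • ({(0 : ℝ)} ×ˢ S) + Set.Icc (0 : ℝ) 1 • Δ + c • Δ =
      ((1 + c) • Δ + t • ({(0 : ℝ)} ×ˢ S)) ∪ coneSection (Prod.mk 1 ⁻¹' Δ) S t c := by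
  have hΔQ : Δ ⊆ Q := by rw [hΔ]; exact Set.inter_subset_left
  have hΔ1 : ∀ d ∈ Δ, (1 : ℝ) ≤ d.1 := by rw [hΔ]; exact fun d hd => hd.2
  have cΔ : Convex ℝ Δ := by
    rw [hΔ]
    exact cQ.inter (convex_halfSpace_ge (f := Prod.fst) (LinearMap.fst ℝ ℝ W).isLinear 1)
  apply Set.Subset.antisymm
  · rintro _ ⟨_, ⟨k, hk, _, ⟨s, hs, d, hd, rfl⟩, rfl⟩, _, ⟨d', hd', rfl⟩, rfl⟩
    have hy : s • d + c • d' ∈ (s + c) • Q := by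
      rw [cQ.add_smul hs.1 hc]
      exact Set.add_mem_add (Set.smul_mem_smul_set (hΔQ hd)) (Set.smul_mem_smul_set (hΔQ hd'))
    have hlev : s + c ≤ (s • d + c • d').1 := by
      have := hΔ1 d hd
      have := hΔ1 d' hd'
      have := hs.1
      simp only [Prod.fst_add, Prod.smul_fst, smul_eq_mul]
      nlinarith
    have e1 : k + s • d + c • d' = (s • d + c • d') + k := by abel
    dsimp only
    rw [e1]
    set y := s • d + c • d'
    rcases le_total (1 + c) y.1 with h | h
    · left
      refine Set.add_mem_add ?_ hk
      rw [Set.mem_smul_set_iff_inv_smul_mem₀ (by positivity), hΔ]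
      constructor
      · obtain ⟨q, hq, hqy⟩ := hy
        dsimp only at hqy
        rw [← hqy, smul_smul]
        refine cQ.smul_mem_of_zero_mem h0 hq ⟨?_, ?_⟩
        · have := hs.1; positivity
        · rw [inv_mul_le_iff₀ (by positivity)]; linarith [hs.2]
      · change 1 ≤ (1 + c)⁻¹ * y.1
        rw [le_inv_mul_iff₀ (by positivity)]
        linarith
    · right
      obtain ⟨⟨k1, k2⟩, ⟨hk1, hk2⟩, rfl⟩ := hk
      have hk1 : k1 = 0 := hk1
      have e2 : (y + t • (k1, k2)).1 = y.1 := by simp [hk1]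
      refine ⟨?_, ?_⟩
      · rw [e2]
        exact ⟨by linarith [hs.1], by linarith⟩
      · simp only
        rw [e2]
        exact Set.add_mem_add
          (snd_mem_smul_slice cQ h0 hΔ hF (add_nonneg hs.1 hc) hlev hy)
          (Set.smul_mem_smul_set hk2)
  · refine Set.union_subset ?_ ?_
    · rw [cΔ.add_smul zero_le_one hc, add_comm (t • _), add_right_comm]
      refine Set.add_subset_add_right (Set.add_subset_add_right ?_)
      rintro _ ⟨d, hd, rfl⟩
      exact Set.smul_mem_smul ⟨zero_le_one, le_rfl⟩ hd
    · rintro ⟨x, w⟩ ⟨hx, _, hf, _, ⟨s, hs, rfl⟩, hw⟩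
      dsimp only at hx hf hw
      rw [add_assoc, add_comm]
      refine ⟨_, smul_add_smul_slice_subset hx hf, t • (0, s),
        Set.smul_mem_smul_set ⟨rfl, hs⟩, ?_⟩
      simp [← hw]

theorem convex_Icc_smul (cΔ : Convex ℝ Δ) : Convex ℝ (Set.Icc (0 : ℝ) 1 • Δ) := by
  rintro _ ⟨s, hs, d, hd, rfl⟩ _ ⟨s', hs', d', hd', rfl⟩ a b ha hb hab
  have h1 : a • s • d + b • s' • d' ∈ (a * s + b * s') • Δ := by
    rw [cΔ.add_smul (mul_nonneg ha hs.1) (mul_nonneg hb hs'.1), smul_smul, smul_smul]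
    exact Set.add_mem_add (Set.smul_mem_smul_set hd) (Set.smul_mem_smul_set hd')
  obtain ⟨d'', hd'', h⟩ := h1
  dsimp only at h ⊢
  rw [← h]
  exact Set.smul_mem_smul ⟨add_nonneg (mul_nonneg ha hs.1) (mul_nonneg hb hs'.1),
    by nlinarith [hs.2, hs'.2]⟩ hd''

theorem isCompact_Icc_smul (hΔ : IsCompact Δ) : IsCompact (Set.Icc (0 : ℝ) 1 • Δ) :=
  isCompact_Icc.smul_set hΔ

variable [FiniteDimensional ℝ W] [MeasurableSpace W] [BorelSpace W]
  (ν : Measure W) [ν.IsAddHaarMeasure]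

theorem measureReal_smul_add_Icc_smul_add_smul (cQ : Convex ℝ Q) (h0 : 0 ∈ Q)
    (hΔ : Δ = Q ∩ {z | 1 ≤ z.1}) (kΔ : IsCompact Δ) (hF : (Prod.mk 1 ⁻¹' Δ).Nonempty)
    (hS : IsCompact S) {c : ℝ} (hc : 0 ≤ c) (t : ℝ) :
    ((volume : Measure ℝ).prod ν).real (t • ({(0 : ℝ)} ×ˢ S) + Set.Icc (0 : ℝ) 1 • Δ + c • Δ) =
      ((volume : Measure ℝ).prod ν).real ((1 + c) • Δ + t • ({(0 : ℝ)} ×ˢ S)) +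
        ((volume : Measure ℝ).prod ν).real (coneSection (Prod.mk 1 ⁻¹' Δ) S t c) := by
  have hΔ1 : ∀ d ∈ Δ, (1 : ℝ) ≤ d.1 := by rw [hΔ]; exact fun d hd => hd.2
  have k1 : IsCompact ((1 + c) • Δ + t • ({(0 : ℝ)} ×ˢ S)) :=
    (kΔ.smul _).add ((isCompact_singleton.prod hS).smul t)
  have k2 := isCompact_coneSection (kΔ.slice 1) hS t c
  have hdisj : AEDisjoint ((volume : Measure ℝ).prod ν) ((1 + c) • Δ + t • ({(0 : ℝ)} ×ˢ S))
      (coneSection (Prod.mk 1 ⁻¹' Δ) S t c) := by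
    refine measure_mono_null (t := {1 + c} ×ˢ Set.univ) ?_ (by simp [Measure.prod_prod])
    rintro z ⟨⟨_, ⟨d, hd, rfl⟩, _, ⟨⟨k1, k2⟩, ⟨hk, -⟩, rfl⟩, rfl⟩, hz⟩
    have hk : k1 = 0 := hk
    have h1 := hz.1.2
    have h2 := hΔ1 d hd
    simp only [hk, Prod.fst_add, Prod.smul_fst, smul_eq_mul, mul_zero, add_zero, Set.mem_prod,
      Set.mem_singleton_iff, Set.mem_univ, and_true] at h1 ⊢
    nlinarith
  rw [smul_add_Icc_smul_add_smul_eq cQ h0 hΔ hF hc, Measure.real,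
    measure_union₀ k2.measurableSet.nullMeasurableSet hdisj,
    ENNReal.toReal_add k1.measure_lt_top.ne k2.measure_lt_top.ne]
  rfl

end Truncation

/-- The Bezout inequality for two bodies, with mixed volumes expressed by finite differences of
volumes of Minkowski sums. -/
def AltSumBezout {E : Type*} [NormedAddCommGroup E] [NormedSpace ℝ E] [MeasurableSpace E]
    (μ : Measure E) (k : ℕ) (Δ : Set E) : Prop :=
  ∀ K L : Set E, Convex ℝ K → IsCompact K → K.Nonempty → Convex ℝ L → IsCompact L → L.Nonempty →
    (k + 2).factorial * μ.real Δ *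
        altSum k (fun c => μ.real (K + L + (c : ℝ) • Δ) - μ.real (K + (c : ℝ) • Δ) -
          μ.real (L + (c : ℝ) • Δ) + μ.real ((c : ℝ) • Δ)) ≤
      altSum (k + 1) (fun c => μ.real (K + (c : ℝ) • Δ) - μ.real ((c : ℝ) • Δ)) *
        altSum (k + 1) (fun c => μ.real (L + (c : ℝ) • Δ) - μ.real ((c : ℝ) • Δ))

section Facet

open Module Topology Filter

variable {W : Type*} [NormedAddCommGroup W] [NormedSpace ℝ W] {Q Δ : Set (ℝ × W)} {S : Set W}
  [FiniteDimensional ℝ W] [MeasurableSpace W] [BorelSpace W]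
  (ν : Measure W) [ν.IsAddHaarMeasure]

theorem measureReal_smul_slab_eq_zero (S : Set W) (t : ℝ) :
    ((volume : Measure ℝ).prod ν).real (t • ({(0 : ℝ)} ×ˢ S)) = 0 := by
  have : ((volume : Measure ℝ).prod ν) (t • ({(0 : ℝ)} ×ˢ S)) = 0 := by
    rw [Measure.addHaar_smul]
    simp [Measure.prod_prod]
  simp [Measure.real, this]

variable {k : ℕ} (hk : finrank ℝ W = k + 1) (cQ : Convex ℝ Q) (h0 : 0 ∈ Q)
  (hΔ : Δ = Q ∩ {z | 1 ≤ z.1}) (kΔ : IsCompact Δ) (hF : (Prod.mk 1 ⁻¹' Δ).Nonempty)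

include cQ h0 hΔ kΔ hF hk

theorem altSum_measureReal_Icc_smul :
    altSum (k + 1) (fun c => ((volume : Measure ℝ).prod ν).real
        (Set.Icc (0 : ℝ) 1 • Δ + (c : ℝ) • Δ) - ((volume : Measure ℝ).prod ν).real ((c : ℝ) • Δ)) =
      (((volume : Measure ℝ).prod ν).real Δ + ν.real (Prod.mk 1 ⁻¹' Δ) / (k + 2)) *
        (k + 2).factorial := by
  have hX : finrank ℝ (ℝ × W) = k + 2 := by simp [hk]; ring
  rw [← altSum_pow, altSum_succ (k + 1), ← altSum_const_mul]
  congr 1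
  ext c
  have h := measureReal_smul_add_Icc_smul_add_smul ν cQ h0 hΔ kΔ hF isCompact_singleton
    (c := c) (by positivity) 0 (S := {0})
  rw [measureReal_coneSection_zero ν (kΔ.slice 1) isCompact_singleton (Set.singleton_nonempty 0)
    (by positivity), Set.zero_smul_set (by simp), zero_add, add_zero,
    measureReal_smul_of_nonneg _ _ (by positivity), hX, hk] at h
  rw [h, measureReal_smul_of_nonneg _ _ (by positivity), hX]
  push_cast
  field_simp
  ring

theorem mul_altSum_coneSection_le (hB : AltSumBezout ((volume : Measure ℝ).prod ν) k Δ)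
    (hS : IsCompact S) (cS : Convex ℝ S) (hS' : S.Nonempty) (t : ℝ) :
    ((volume : Measure ℝ).prod ν).real Δ *
        altSum k (fun c => ((volume : Measure ℝ).prod ν).real
            (coneSection (Prod.mk 1 ⁻¹' Δ) S t c) -
          ((volume : Measure ℝ).prod ν).real (coneSection (Prod.mk 1 ⁻¹' Δ) S 0 c)) ≤
      altSum (k + 1) (fun c => ((volume : Measure ℝ).prod ν).real
          ((c : ℝ) • Δ + t • ({(0 : ℝ)} ×ˢ S)) - ((volume : Measure ℝ).prod ν).real ((c : ℝ) • Δ)) *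
        (ν.real (Prod.mk 1 ⁻¹' Δ) / (k + 2)) := by
  have hX : finrank ℝ (ℝ × W) = k + 2 := by simp [hk]; ring
  have cΔ : Convex ℝ Δ := by
    rw [hΔ]
    exact cQ.inter (convex_halfSpace_ge (f := Prod.fst) (LinearMap.fst ℝ ℝ W).isLinear 1)
  obtain ⟨f, hf⟩ := id hF
  have hΔ' : Δ.Nonempty := ⟨_, hf⟩
  set μ := (volume : Measure ℝ).prod ν
  set L := Set.Icc (0 : ℝ) 1 • Δ with hL
  have h := hB (t • ({(0 : ℝ)} ×ˢ S)) L (((convex_singleton 0).prod cS).smul t)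
    ((isCompact_singleton.prod hS).smul t) ((Set.singleton_nonempty _).prod hS').smul_set
    (convex_Icc_smul cΔ) (isCompact_Icc_smul kΔ)
    ((Set.nonempty_Icc.2 zero_le_one).smul hΔ')
  rw [altSum_measureReal_Icc_smul ν hk cQ h0 hΔ kΔ hF] at h
  simp only [add_comm (t • ({(0 : ℝ)} ×ˢ S)) (_ • Δ)] at h
  have e1 : (fun c : ℕ => μ.real (t • ({(0 : ℝ)} ×ˢ S) + L + (c : ℝ) • Δ) -
      μ.real ((c : ℝ) • Δ + t • ({(0 : ℝ)} ×ˢ S)) - μ.real (L + (c : ℝ) • Δ) +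
        μ.real ((c : ℝ) • Δ)) =
      fun c : ℕ => ((μ.real (((c + 1 : ℕ) : ℝ) • Δ + t • ({(0 : ℝ)} ×ˢ S)) -
        μ.real (((c + 1 : ℕ) : ℝ) • Δ)) - (μ.real ((c : ℝ) • Δ + t • ({(0 : ℝ)} ×ˢ S)) -
        μ.real ((c : ℝ) • Δ))) +
        (μ.real (coneSection (Prod.mk 1 ⁻¹' Δ) S t c) -
          μ.real (coneSection (Prod.mk 1 ⁻¹' Δ) S 0 c)) := by
    ext c
    have h1 := measureReal_smul_add_Icc_smul_add_smul ν cQ h0 hΔ kΔ hF hS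
      (c := c) (by positivity) t
    have h2 := measureReal_smul_add_Icc_smul_add_smul ν cQ h0 hΔ kΔ hF hS
      (c := c) (by positivity) 0
    rw [Set.zero_smul_set (by simpa using hS'), zero_add, add_zero] at h2
    rw [h1, h2]
    push_cast
    rw [add_comm (c : ℝ) 1]
    ring
  rw [e1, altSum_add, ← altSum_succ k (fun c : ℕ => μ.real ((c : ℝ) • Δ + t • ({(0 : ℝ)} ×ˢ S)) -
        μ.real ((c : ℝ) • Δ))] at h
  have hfac : (0 : ℝ) < (k + 2).factorial := by positivity
  refine le_of_mul_le_mul_left ?_ hfac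
  linarith

theorem mul_deriv_slice_le (hB : AltSumBezout ((volume : Measure ℝ).prod ν) k Δ)
    (iF : (interior (Prod.mk 1 ⁻¹' Δ)).Nonempty)
    (hS : IsCompact S) (cS : Convex ℝ S) (hS' : S.Nonempty) {g G : ℝ}
    (hg : HasDerivWithinAt (fun t : ℝ => ν.real (Prod.mk 1 ⁻¹' Δ + t • S)) g (Set.Ioi 0) 0)
    (hG : HasDerivWithinAt (fun t : ℝ => ((volume : Measure ℝ).prod ν).real
      (Δ + t • ({(0 : ℝ)} ×ˢ S))) G (Set.Ioi 0) 0) :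
    ((volume : Measure ℝ).prod ν).real Δ * (g / (k + 1)) ≤
      G * (ν.real (Prod.mk 1 ⁻¹' Δ) / (k + 2)) := by
  have hX : finrank ℝ (ℝ × W) = (k + 1) + 1 := by simp [hk]; ring
  have cΔ : Convex ℝ Δ := by
    rw [hΔ]
    exact cQ.inter (convex_halfSpace_ge (f := Prod.fst) (LinearMap.fst ℝ ℝ W).isLinear 1)
  have cF : Convex ℝ (Prod.mk (1 : ℝ) ⁻¹' Δ) := by
    intro x hx y hy a b ha hb hab
    have := cΔ hx hy ha hb hab
    simpa [hab] using this
  have l1 : Tendsto (fun t => altSum k (fun c => (((volume : Measure ℝ).prod ν).real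
            (coneSection (Prod.mk 1 ⁻¹' Δ) S t c) -
          ((volume : Measure ℝ).prod ν).real (coneSection (Prod.mk 1 ⁻¹' Δ) S 0 c)) / t)) (𝓝[>] 0)
      (𝓝 (altSum k (fun c => g * ((((c : ℝ) + 1) ^ (k + 1) - (c : ℝ) ^ (k + 1)) / (k + 1))))) :=
    Filter.Tendsto.altSum k fun c => tendsto_measureReal_coneSection ν (kΔ.slice 1) cF iF hS hS'
      hg hk (by positivity)
  have l2 : Tendsto (fun t => altSum (k + 1) (fun c => (((volume : Measure ℝ).prod ν).real
          ((c : ℝ) • Δ + t • ({(0 : ℝ)} ×ˢ S)) -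
          ((volume : Measure ℝ).prod ν).real ((c : ℝ) • Δ)) / t)) (𝓝[>] 0)
      (𝓝 (altSum (k + 1) (fun c => G * (c : ℝ) ^ (k + 1)))) := by
    refine Filter.Tendsto.altSum (k + 1) fun c => ?_
    rcases c.eq_zero_or_pos with rfl | hc
    · have hΔ' : Δ.Nonempty := by
        obtain ⟨f, hf⟩ := hF
        exact ⟨_, hf⟩
      have : ((volume : Measure ℝ).prod ν).real (0 : Set (ℝ × W)) = 0 := by
        have := measureReal_smul_slab_eq_zero ν {(0 : W)} 0
        rwa [Set.zero_smul_set (by simp)] at this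
      simp [Set.zero_smul_set hΔ', measureReal_smul_slab_eq_zero, this]
    · have := tendsto_measureReal_smul_add_smul _ hG ((Set.singleton_nonempty _).prod hS') hX
        (x := c) (by positivity)
      rwa [mul_comm] at this
  have hle : ∀ᶠ t in 𝓝[>] (0 : ℝ), ((volume : Measure ℝ).prod ν).real Δ *
      altSum k (fun c => (((volume : Measure ℝ).prod ν).real
            (coneSection (Prod.mk 1 ⁻¹' Δ) S t c) -
          ((volume : Measure ℝ).prod ν).real (coneSection (Prod.mk 1 ⁻¹' Δ) S 0 c)) / t) ≤
      altSum (k + 1) (fun c => (((volume : Measure ℝ).prod ν).real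
          ((c : ℝ) • Δ + t • ({(0 : ℝ)} ×ˢ S)) -
          ((volume : Measure ℝ).prod ν).real ((c : ℝ) • Δ)) / t) *
        (ν.real (Prod.mk 1 ⁻¹' Δ) / (k + 2)) := by
    filter_upwards [self_mem_nhdsWithin] with t (ht : 0 < t)
    have h := mul_altSum_coneSection_le ν hk cQ h0 hΔ kΔ hF hB hS cS hS' t
    simp only [div_eq_inv_mul _ t, altSum_const_mul]
    rw [mul_left_comm, mul_assoc]
    exact mul_le_mul_of_nonneg_left h (inv_nonneg.2 ht.le)
  have h := le_of_tendsto_of_tendsto (l1.const_mul _) (l2.mul_const _) hle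
  rw [altSum_const_mul, altSum_const_mul, altSum_pow] at h
  have e1 : altSum k (fun c => (((c : ℝ) + 1) ^ (k + 1) - (c : ℝ) ^ (k + 1)) / (k + 1)) =
      (k + 1).factorial / (k + 1) := by
    simp only [div_eq_inv_mul _ ((k : ℝ) + 1), altSum_const_mul]
    rw [← altSum_pow, altSum_succ]
    push_cast
    rfl
  rw [e1] at h
  have hfac : (0 : ℝ) < (k + 1).factorial := by positivity
  refine le_of_mul_le_mul_left ?_ hfac
  calc _ = _ := by ring
    _ ≤ _ := h
    _ = _ := by ring

end Facet

section Cone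

open Module Topology Filter

variable {W : Type*} [NormedAddCommGroup W] [NormedSpace ℝ W] {Q Δ : Set (ℝ × W)}

theorem interior_slice_nonempty (cQ : Convex ℝ Q) (h0 : 0 ∈ Q)
    (hΔ : Δ = Q ∩ {z | 1 ≤ z.1}) (iΔ : (interior Δ).Nonempty) :
    (interior (Prod.mk (1 : ℝ) ⁻¹' Δ)).Nonempty := by
  obtain ⟨⟨x, w⟩, hz⟩ := iΔ
  have hx : 1 ≤ x := by
    have := interior_subset hz
    rw [hΔ] at this
    exact this.2
  have hx0 : 0 < x := by linarith
  refine ⟨x⁻¹ • w, mem_interior.2 ⟨(fun v : W => (x, x • v)) ⁻¹' interior Δ, ?_,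
    isOpen_interior.preimage (by fun_prop), ?_⟩⟩
  · intro v hv
    have h1 := interior_subset hv
    rw [hΔ] at h1
    have h2 := cQ.smul_mem_of_zero_mem h0 h1.1 (t := x⁻¹) ⟨by positivity, inv_le_one_of_one_le₀ hx⟩
    simp only [Prod.smul_mk, smul_eq_mul, inv_mul_cancel₀ hx0.ne', smul_smul, one_smul] at h2
    rw [Set.mem_preimage, hΔ]
    exact ⟨h2, le_refl (1 : ℝ)⟩
  · simpa [smul_smul, hx0.ne'] using hz

theorem smul_slice_add_subset {q : ℝ × W} {ε : ℝ}
    (hε : ε ∈ Set.Icc 0 (q.1 - 1)) (hq1 : 1 < q.1) :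
    (1 - ε / (q.1 - 1)) • (Prod.mk 1 ⁻¹' Δ) + {(ε / (q.1 - 1)) • q.2} ⊆
      Prod.mk (1 + ε) ⁻¹' ((fun y : ℝ × W => (1 - y.1) • ((1 : ℝ), y.2) + y.1 • q) ''
        (Set.Icc 0 1 ×ˢ (Prod.mk 1 ⁻¹' Δ))) := by
  have hh : 0 < q.1 - 1 := by linarith
  rintro _ ⟨_, ⟨f, hf, rfl⟩, _, rfl, rfl⟩
  refine ⟨(ε / (q.1 - 1), f), ⟨⟨div_nonneg hε.1 hh.le, div_le_one_of_le₀ hε.2 hh.le⟩, hf⟩, ?_⟩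
  refine Prod.ext ?_ ?_
  · simp only [Prod.fst_add, Prod.smul_fst, smul_eq_mul]
    field_simp
    ring
  · simp

theorem cone_subset (cΔ : Convex ℝ Δ) {q : ℝ × W} (hq : q ∈ Δ) :
    (fun y : ℝ × W => (1 - y.1) • ((1 : ℝ), y.2) + y.1 • q) ''
        (Set.Icc 0 1 ×ˢ (Prod.mk 1 ⁻¹' Δ)) ⊆ Δ := by
  rintro _ ⟨⟨s, f⟩, ⟨hs, hf⟩, rfl⟩
  exact cΔ hf hq (sub_nonneg.2 hs.2) hs.1 (by simp)

theorem setIntegral_Icc_one_sub_mul_pow {a : ℝ} (ha : a ≠ 0) {h : ℝ} (hh : 0 ≤ h) (m : ℕ) :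
    ∫ x in Set.Icc 1 (1 + h), (1 - a * (x - 1)) ^ m =
      (1 - (1 - a * h) ^ (m + 1)) / (a * (m + 1)) := by
  rw [integral_Icc_eq_integral_Ioc, ← intervalIntegral.integral_of_le (by linarith)]
  rw [intervalIntegral.integral_eq_sub_of_hasDerivAt
    (f := fun x => -(1 - a * (x - 1)) ^ (m + 1) / (a * (m + 1)))]
  · have : (m : ℝ) + 1 ≠ 0 := by positivity
    simp only [add_sub_cancel_left, sub_self, mul_zero, sub_zero, one_pow]
    ring
  · intro x _
    have h1 : HasDerivAt (fun x : ℝ => 1 - a * (x - 1)) (-a) x := by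
      simpa using (((hasDerivAt_id x).sub_const 1).const_mul a).const_sub 1
    have h2 := ((h1.pow (m + 1)).neg).div_const (a * (m + 1))
    have : (m : ℝ) + 1 ≠ 0 := by positivity
    refine h2.congr_deriv ?_
    push_cast
    field_simp
  · apply Continuous.intervalIntegrable
    fun_prop

variable [FiniteDimensional ℝ W] [MeasurableSpace W] [BorelSpace W]
  (ν : Measure W) [ν.IsAddHaarMeasure]

theorem setIntegral_le_measureReal_of_le_slice {A : Set (ℝ × W)} (hA : IsCompact A) {a b : ℝ}
    {φ : ℝ → ℝ} (hφ : Continuous φ)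
    (h : ∀ x ∈ Set.Icc a b, φ x ≤ ν.real (Prod.mk x ⁻¹' A)) :
    ∫ x in Set.Icc a b, φ x ≤ ((volume : Measure ℝ).prod ν).real A := by
  rw [measureReal_prod_eq_integral_slice ν hA]
  refine (setIntegral_mono_on (hφ.integrableOn_Icc)
    (integrable_measureReal_slice ν hA).integrableOn measurableSet_Icc h).trans ?_
  exact setIntegral_le_integral (integrable_measureReal_slice ν hA)
    (.of_forall fun _ => measureReal_nonneg)

theorem measureReal_le_setIntegral_of_slice_le {A : Set (ℝ × W)} (hA : IsCompact A) {a b : ℝ}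
    {φ : ℝ → ℝ} (hφ : Continuous φ) (hab : ∀ z ∈ A, z.1 ∈ Set.Icc a b)
    (h : ∀ x ∈ Set.Icc a b, ν.real (Prod.mk x ⁻¹' A) ≤ φ x) :
    ((volume : Measure ℝ).prod ν).real A ≤ ∫ x in Set.Icc a b, φ x := by
  rw [measureReal_prod_eq_integral_slice ν hA, ← setIntegral_eq_integral_of_forall_compl_eq_zero
    (s := Set.Icc a b)]
  · exact setIntegral_mono_on (integrable_measureReal_slice ν hA).integrableOn
      (hφ.integrableOn_Icc) measurableSet_Icc h
  · intro x hx
    have : Prod.mk x ⁻¹' A = ∅ := by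
      ext w
      simp only [Set.mem_preimage, Set.mem_empty_iff_false, iff_false]
      exact fun hw => hx (hab _ hw)
    simp [this]

theorem measureReal_slice_cone_ge (kΔ : IsCompact Δ) {q : ℝ × W}
    {ε : ℝ} (hε : ε ∈ Set.Icc 0 (q.1 - 1)) (hq1 : 1 < q.1) :
    (1 - ε / (q.1 - 1)) ^ finrank ℝ W * ν.real (Prod.mk (1 : ℝ) ⁻¹' Δ) ≤
      ν.real (Prod.mk (1 + ε) ⁻¹' ((fun y : ℝ × W => (1 - y.1) • ((1 : ℝ), y.2) + y.1 • q) ''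
        (Set.Icc 0 1 ×ˢ (Prod.mk 1 ⁻¹' Δ)))) := by
  have hh : 0 < q.1 - 1 := by linarith
  rw [← measureReal_smul_of_nonneg ν _ (sub_nonneg.2 (div_le_one_of_le₀ hε.2 hh.le)),
    ← measureReal_add_singleton ν _ ((ε / (q.1 - 1)) • q.2)]
  refine measureReal_mono (smul_slice_add_subset hε hq1) (IsCompact.slice ?_ _).measure_lt_top.ne
  exact (isCompact_Icc.prod (kΔ.slice 1)).image (by fun_prop)

theorem measureReal_slice_ge (kΔ : IsCompact Δ) (cΔ : Convex ℝ Δ) {q : ℝ × W} (hq : q ∈ Δ)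
    {ε : ℝ} (hε : ε ∈ Set.Icc 0 (q.1 - 1)) (hq1 : 1 < q.1) :
    (1 - ε / (q.1 - 1)) ^ finrank ℝ W * ν.real (Prod.mk (1 : ℝ) ⁻¹' Δ) ≤
      ν.real (Prod.mk (1 + ε) ⁻¹' Δ) :=
  (measureReal_slice_cone_ge ν kΔ hε hq1).trans <|
    measureReal_mono (Set.preimage_mono (cone_subset cΔ hq)) (kΔ.slice _).measure_lt_top.ne

theorem measureReal_inter_le_ge (kΔ : IsCompact Δ) (cΔ : Convex ℝ Δ) {q : ℝ × W} (hq : q ∈ Δ)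
    {σ : ℝ} (hσ : σ ∈ Set.Icc 0 (q.1 - 1)) (hq1 : 1 < q.1) :
    σ * ((1 - σ / (q.1 - 1)) ^ finrank ℝ W * ν.real (Prod.mk (1 : ℝ) ⁻¹' Δ)) ≤
      ((volume : Measure ℝ).prod ν).real (Δ ∩ {z | z.1 ≤ 1 + σ}) := by
  have hh : 0 < q.1 - 1 := by linarith
  have hclosed : IsClosed {z : ℝ × W | z.1 ≤ 1 + σ} := isClosed_le continuous_fst continuous_const
  have h := setIntegral_le_measureReal_of_le_slice ν (kΔ.inter_right hclosed) (a := 1) (b := 1 + σ)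
    (φ := fun _ => (1 - σ / (q.1 - 1)) ^ finrank ℝ W * ν.real (Prod.mk (1 : ℝ) ⁻¹' Δ))
    continuous_const ?_
  · rw [setIntegral_const] at h
    simpa [Measure.real, hσ.1] using h
  · intro x hx
    have h1 := measureReal_slice_ge ν kΔ cΔ hq (ε := x - 1)
      ⟨by linarith [hx.1], by linarith [hx.2, hσ.2]⟩ hq1
    have e1 : Prod.mk x ⁻¹' (Δ ∩ {z | z.1 ≤ 1 + σ}) = Prod.mk x ⁻¹' Δ := by
      ext w
      simp [hx.2]
    rw [e1]
    rw [add_sub_cancel] at h1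
    refine le_trans ?_ h1
    have h2 : 0 ≤ 1 - σ / (q.1 - 1) := sub_nonneg.2 (div_le_one_of_le₀ hσ.2 hh.le)
    have h3 : x - 1 ≤ σ := by linarith [hx.2]
    gcongr

theorem measureReal_add_smul_slab_le (hΔ1 : ∀ z ∈ Δ, (1 : ℝ) ≤ z.1) (kΔ : IsCompact Δ)
    (cΔ : Convex ℝ Δ) {q : ℝ × W} (hq : q ∈ Δ) (hq1 : 1 < q.1)
    {ε : ℝ} (hε : ε ∈ Set.Icc 0 (q.1 - 1)) {t : ℝ} (ht : 0 ≤ t) :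
    ((volume : Measure ℝ).prod ν).real (Δ + t • ({(0 : ℝ)} ×ˢ (Prod.mk (1 + ε) ⁻¹' Δ))) ≤
      (1 + t) ^ (finrank ℝ W + 1) * (((volume : Measure ℝ).prod ν).real Δ -
        t * ε / (1 + t) * ((1 - t * ε / (1 + t) / (q.1 - 1)) ^ finrank ℝ W *
          ν.real (Prod.mk (1 : ℝ) ⁻¹' Δ))) := by
  set μ := (volume : Measure ℝ).prod ν
  set σ := t * ε / (1 + t) with hσdef
  have ht1 : 0 < 1 + t := by linarith
  have hσ : σ ∈ Set.Icc 0 (q.1 - 1) := by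
    refine ⟨div_nonneg (mul_nonneg ht hε.1) ht1.le, ?_⟩
    rw [hσdef, div_le_iff₀ ht1]
    nlinarith [hε.1, hε.2, mul_le_mul_of_nonneg_left hε.2 ht]
  have hσt : (1 + t) * σ = t * ε := by rw [hσdef]; field_simp
  have k1 : IsCompact (Δ ∩ {z | z.1 ≤ 1 + σ}) :=
    kΔ.inter_right (isClosed_le continuous_fst continuous_const)
  have k2 : IsCompact (Δ ∩ {z | 1 + σ ≤ z.1}) :=
    kΔ.inter_right (isClosed_le continuous_const continuous_fst)
  have hV : μ.real (Δ ∩ {z | 1 + σ ≤ z.1}) + μ.real (Δ ∩ {z | z.1 ≤ 1 + σ}) = μ.real Δ := by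
    rw [← measureReal_union_add_inter k1.measurableSet k2.measure_lt_top.ne k1.measure_lt_top.ne,
      ← Set.inter_union_distrib_left]
    have e1 : {z : ℝ × W | 1 + σ ≤ z.1} ∪ {z | z.1 ≤ 1 + σ} = Set.univ := by
      ext z; simpa using le_total _ _
    have e2 : μ ((Δ ∩ {z | 1 + σ ≤ z.1}) ∩ (Δ ∩ {z | z.1 ≤ 1 + σ})) = 0 := by
      refine measure_mono_null (t := {1 + σ} ×ˢ Set.univ) ?_ (by simp [μ, Measure.prod_prod])
      rintro z ⟨⟨-, h1⟩, -, h2⟩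
      exact ⟨le_antisymm h2 h1, trivial⟩
    rw [e1, Set.inter_univ, Measure.real, Measure.real, e2]
    simp
  have h1 := measureReal_inter_le_ge ν kΔ cΔ hq hσ hq1
  have h2 : μ.real (Δ + t • ({(0 : ℝ)} ×ˢ (Prod.mk (1 + ε) ⁻¹' Δ))) ≤
      μ.real ((1 + t) • (Δ ∩ {z | 1 + σ ≤ z.1})) := by
    rw [← measureReal_add_singleton μ _ (t * (1 + ε), (0 : W))]
    refine measureReal_mono ?_ (k2.smul _).measure_lt_top.ne
    rintro _ ⟨_, ⟨d, hd, _, ⟨⟨x, w⟩, ⟨hx, hw⟩, rfl⟩, rfl⟩, _, rfl, rfl⟩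
    have hx : x = 0 := hx
    subst hx
    have h3 : d + t • ((1 + ε), w) ∈ (1 + t) • Δ := by
      rw [cΔ.add_smul zero_le_one ht, one_smul]
      exact Set.add_mem_add hd (Set.smul_mem_smul_set hw)
    have e1 : d + t • ((0 : ℝ), w) + (t * (1 + ε), (0 : W)) = d + t • ((1 + ε), w) := by
      rw [add_assoc]
      simp
    dsimp only
    rw [e1]
    obtain ⟨d', hd', h4⟩ := h3
    refine ⟨d', ⟨hd', ?_⟩, h4⟩
    have h5 := congrArg Prod.fst h4
    simp only [Prod.smul_fst, Prod.fst_add, smul_eq_mul] at h5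
    have := hΔ1 d hd
    change 1 + σ ≤ d'.1
    refine le_of_mul_le_mul_left ?_ ht1
    rw [h5]
    linarith
  rw [measureReal_smul_of_nonneg μ _ ht1.le] at h2
  have hX : finrank ℝ (ℝ × W) = finrank ℝ W + 1 := by simp [add_comm]
  rw [hX] at h2
  refine h2.trans ?_
  gcongr
  linarith

end Cone

section ConeCharacterization

open Module Topology Filter

theorem le_of_hasDerivWithinAt_Ioi_of_le {f u : ℝ → ℝ} {a f' u' : ℝ}
    (hf : HasDerivWithinAt f f' (Set.Ioi a) a) (hu : HasDerivWithinAt u u' (Set.Ioi a) a)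
    (h0 : f a = u a) (h : ∀ t, a < t → f t ≤ u t) : f' ≤ u' := by
  have h1 := (hasDerivWithinAt_iff_tendsto_slope' (by simp)).1 (hu.sub hf)
  refine sub_nonneg.1 (ge_of_tendsto h1 ?_)
  filter_upwards [self_mem_nhdsWithin] with t (ht : a < t)
  rw [slope_def_field]
  refine div_nonneg ?_ (sub_nonneg.2 ht.le)
  simp only [Pi.sub_apply, h0, sub_self, sub_zero]
  exact sub_nonneg.2 (h t ht)

theorem hasDerivAt_one_add_pow_mul_sub (m : ℕ) (V b ε h : ℝ) :
    HasDerivAt (fun t : ℝ => (1 + t) ^ (m + 1) * (V - t * ε / (1 + t) *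
      ((1 - t * ε / (1 + t) / h) ^ m * b))) ((m + 1) * V - ε * b) 0 := by
  have h1 : HasDerivAt (fun t : ℝ => 1 + t) 1 0 := (hasDerivAt_id (0 : ℝ)).const_add 1
  have h2 : HasDerivAt (fun t : ℝ => t * ε / (1 + t)) ε 0 := by
    refine (((hasDerivAt_id (0 : ℝ)).mul_const ε).div h1 (by simp)).congr_deriv ?_
    simp
  have h3 := (((h2.div_const h).const_sub 1).pow m).mul_const b
  refine ((h1.pow (m + 1)).mul ((h2.mul h3).const_sub V)).congr_deriv ?_
  simp
  ring

variable {W : Type*} [NormedAddCommGroup W] [NormedSpace ℝ W] {Q Δ : Set (ℝ × W)}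
  [FiniteDimensional ℝ W] [MeasurableSpace W] [BorelSpace W]
  (ν : Measure W) [ν.IsAddHaarMeasure]

theorem deriv_add_smul_slab_le (hΔ1 : ∀ z ∈ Δ, (1 : ℝ) ≤ z.1) (kΔ : IsCompact Δ)
    (cΔ : Convex ℝ Δ) {q : ℝ × W} (hq : q ∈ Δ) (hq1 : 1 < q.1)
    {ε : ℝ} (hε : ε ∈ Set.Icc 0 (q.1 - 1)) (hS' : (Prod.mk (1 + ε) ⁻¹' Δ).Nonempty) {G : ℝ}
    (hG : HasDerivWithinAt (fun t : ℝ => ((volume : Measure ℝ).prod ν).real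
      (Δ + t • ({(0 : ℝ)} ×ˢ (Prod.mk (1 + ε) ⁻¹' Δ)))) G (Set.Ioi 0) 0) :
    G ≤ (finrank ℝ W + 1) * ((volume : Measure ℝ).prod ν).real Δ -
      ε * ν.real (Prod.mk (1 : ℝ) ⁻¹' Δ) := by
  refine le_of_hasDerivWithinAt_Ioi_of_le hG
    (hasDerivAt_one_add_pow_mul_sub (finrank ℝ W) _ _ ε (q.1 - 1)).hasDerivWithinAt ?_
    fun t ht => measureReal_add_smul_slab_le ν hΔ1 kΔ cΔ hq hq1 hε ht.le
  rw [Set.zero_smul_set ((Set.singleton_nonempty _).prod hS')]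
  simp

variable {k : ℕ} (hk : finrank ℝ W = k + 1) (cQ : Convex ℝ Q) (h0 : 0 ∈ Q)
  (hΔ : Δ = Q ∩ {z | 1 ≤ z.1}) (kΔ : IsCompact Δ) (iΔ : (interior Δ).Nonempty)

include cQ h0 hΔ kΔ iΔ hk

theorem measureReal_slice_le_of_altSumBezout
    (hB : AltSumBezout ((volume : Measure ℝ).prod ν) k Δ)
    {q : ℝ × W} (hq : q ∈ Δ) (hq1 : 1 < q.1) {ε : ℝ} (hε : ε ∈ Set.Icc 0 (q.1 - 1)) :
    0 ≤ 1 - ν.real (Prod.mk (1 : ℝ) ⁻¹' Δ) / ((k + 2) * ((volume : Measure ℝ).prod ν).real Δ) * ε ∧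
    ν.real (Prod.mk (1 + ε) ⁻¹' Δ) ≤ (1 - ν.real (Prod.mk (1 : ℝ) ⁻¹' Δ) /
      ((k + 2) * ((volume : Measure ℝ).prod ν).real Δ) * ε) ^ (k + 1) *
        ν.real (Prod.mk (1 : ℝ) ⁻¹' Δ) := by
  have hh : 0 < q.1 - 1 := by linarith
  have cΔ : Convex ℝ Δ := by
    rw [hΔ]
    exact cQ.inter (convex_halfSpace_ge (f := Prod.fst) (LinearMap.fst ℝ ℝ W).isLinear 1)
  have hΔ1 : ∀ z ∈ Δ, (1 : ℝ) ≤ z.1 := fun z hz => by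
    rw [hΔ] at hz
    exact hz.2
  have cF : ∀ x, Convex ℝ (Prod.mk x ⁻¹' Δ) := by
    intro s x hx y hy a b ha hb hab
    have := cΔ hx hy ha hb hab
    simpa [← add_mul, hab] using this
  have : Nontrivial W := Module.nontrivial_of_finrank_pos (R := ℝ) (by omega)
  have iF := interior_slice_nonempty cQ h0 hΔ iΔ
  have hS' : (Prod.mk (1 + ε) ⁻¹' Δ).Nonempty := by
    obtain ⟨f, hf⟩ := iF.mono interior_subset
    exact ⟨_, cone_subset cΔ hq (smul_slice_add_subset hε hq1
      (Set.add_mem_add (Set.smul_mem_smul_set hf) rfl))⟩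
  obtain ⟨g, hg, hg'⟩ := exists_hasDerivWithinAt_measureReal_add_smul ν (kΔ.slice 1) (cF 1) iF
    (kΔ.slice (1 + ε)) hS'
  obtain ⟨G, hG, -⟩ := exists_hasDerivWithinAt_measureReal_add_smul ((volume : Measure ℝ).prod ν)
    kΔ cΔ iΔ (isCompact_singleton.prod (kΔ.slice (1 + ε))) ((Set.singleton_nonempty (0 : ℝ)).prod hS')
  have h1 := mul_deriv_slice_le ν hk cQ h0 hΔ kΔ (iF.mono interior_subset) hB iF
    (kΔ.slice (1 + ε)) (cF _) hS' hg hG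
  have h2 := deriv_add_smul_slab_le ν hΔ1 kΔ cΔ hq hq1 hε hS' hG
  have hV := measureReal_pos_of_interior_nonempty ((volume : Measure ℝ).prod ν) kΔ iΔ
  have hb := measureReal_pos_of_interior_nonempty ν (kΔ.slice 1) iF
  rw [hk] at hg' h2
  set V := ((volume : Measure ℝ).prod ν).real Δ
  set b := ν.real (Prod.mk (1 : ℝ) ⁻¹' Δ)
  set A := ν.real (Prod.mk (1 + ε) ⁻¹' Δ)
  set β := b ^ ((k + 1 : ℕ) : ℝ)⁻¹ with hβd
  set α := A ^ ((k + 1 : ℕ) : ℝ)⁻¹ with hαd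
  have hβ : 0 < β := by positivity
  have hα : 0 ≤ α := Real.rpow_nonneg measureReal_nonneg _
  have eα : α ^ (k + 1) = A := Real.rpow_inv_natCast_pow measureReal_nonneg (by omega)
  have eβ : β ^ (k + 1) = b := Real.rpow_inv_natCast_pow hb.le (by omega)
  have h3 : α ≤ β * (1 - b / ((k + 2) * V) * ε) := by
    rw [add_tsub_cancel_right] at hg'
    push_cast at hg' h2
    have h4 : V * (β ^ k * α) ≤ V * (g / (k + 1)) := by
      gcongr
      rw [le_div_iff₀ (by positivity)]
      linarith
    have h5 : G * (b / (k + 2)) ≤ (((k : ℝ) + 1 + 1) * V - ε * b) * (b / (k + 2)) := by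
      gcongr
    have h6 := h4.trans (h1.trans h5)
    have h7 : 0 < V * β ^ k := by positivity
    refine le_of_mul_le_mul_left ?_ h7
    calc V * β ^ k * α = V * (β ^ k * α) := by ring
      _ ≤ _ := h6
      _ = V * b * (1 - b / ((k + 2) * V) * ε) := by field_simp; ring
      _ = V * β ^ (k + 1) * (1 - b / ((k + 2) * V) * ε) := by rw [eβ]
      _ = _ := by ring
  have h8 : 0 ≤ 1 - b / ((k + 2) * V) * ε := by
    refine le_of_mul_le_mul_left ?_ hβ
    linarith
  refine ⟨h8, ?_⟩
  calc A = α ^ (k + 1) := eα.symm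
    _ ≤ (β * (1 - b / ((k + 2) * V) * ε)) ^ (k + 1) := by gcongr
    _ = _ := by rw [mul_pow, eβ, mul_comm]

/-- A truncated cone satisfying the Bezout inequality is itself a cone over the truncating
facet. -/
theorem eq_cone_of_altSumBezout (hB : AltSumBezout ((volume : Measure ℝ).prod ν) k Δ)
    {q : ℝ × W} (hq : q ∈ Δ) (hmax : ∀ z ∈ Δ, z.1 ≤ q.1) (hq1 : 1 < q.1) :
    (fun y : ℝ × W => (1 - y.1) • ((1 : ℝ), y.2) + y.1 • q) ''
        (Set.Icc 0 1 ×ˢ (Prod.mk 1 ⁻¹' Δ)) = Δ := by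
  have hh : 0 < q.1 - 1 := by linarith
  have cΔ : Convex ℝ Δ := by
    rw [hΔ]
    exact cQ.inter (convex_halfSpace_ge (f := Prod.fst) (LinearMap.fst ℝ ℝ W).isLinear 1)
  have hΔ1 : ∀ z ∈ Δ, (1 : ℝ) ≤ z.1 := fun z hz => by
    rw [hΔ] at hz
    exact hz.2
  have hV := measureReal_pos_of_interior_nonempty ((volume : Measure ℝ).prod ν) kΔ iΔ
  have hb := measureReal_pos_of_interior_nonempty ν (kΔ.slice 1)
    (interior_slice_nonempty cQ h0 hΔ iΔ)
  have hsl := fun ε hε => measureReal_slice_le_of_altSumBezout ν hk cQ h0 hΔ kΔ iΔ hB hq hq1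
    (ε := ε) hε
  set C := (fun y : ℝ × W => (1 - y.1) • ((1 : ℝ), y.2) + y.1 • q) ''
        (Set.Icc 0 1 ×ˢ (Prod.mk 1 ⁻¹' Δ)) with hC
  have kC : IsCompact C := (isCompact_Icc.prod (kΔ.slice 1)).image (by fun_prop)
  have hCΔ : C ⊆ Δ := cone_subset cΔ hq
  set μ := (volume : Measure ℝ).prod ν
  set V := μ.real Δ
  set b := ν.real (Prod.mk (1 : ℝ) ⁻¹' Δ)
  set κ := b / ((k + 2) * V) with hκ
  have hκ0 : 0 < κ := by positivity
  have hle : V ≤ ∫ x in Set.Icc 1 (1 + (q.1 - 1)), (1 - κ * (x - 1)) ^ (k + 1) * b := by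
    refine measureReal_le_setIntegral_of_slice_le ν kΔ (by fun_prop)
      (fun z hz => ⟨hΔ1 z hz, by linarith [hmax z hz]⟩) fun x hx => ?_
    have := (hsl (x - 1) ⟨by linarith [hx.1], by linarith [hx.2]⟩).2
    rwa [add_sub_cancel] at this
  rw [integral_mul_const, setIntegral_Icc_one_sub_mul_pow hκ0.ne' hh.le] at hle
  have hκ1 : κ * (q.1 - 1) = 1 := by
    have h1 := (hsl (q.1 - 1) ⟨hh.le, le_rfl⟩).1
    have e : ∀ y : ℝ, (1 - y) / (κ * ((k + 1 : ℕ) + 1)) * b = V * (1 - y) := by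
      intro y
      rw [hκ]
      push_cast
      field_simp
      ring
    rw [e] at hle
    have h2 : (1 - κ * (q.1 - 1)) ^ (k + 1 + 1) ≤ 0 := by
      by_contra! h
      nlinarith
    have h3 := pow_eq_zero_iff (n := k + 1 + 1) (by omega) |>.1 (le_antisymm h2 (pow_nonneg h1 _))
    linarith
  have hge : V ≤ μ.real C := by
    have h1 := setIntegral_le_measureReal_of_le_slice ν kC (a := 1) (b := 1 + (q.1 - 1))
      (φ := fun x => (1 - κ * (x - 1)) ^ (k + 1) * b) (by fun_prop) ?_
    · rw [integral_mul_const, setIntegral_Icc_one_sub_mul_pow hκ0.ne' hh.le, hκ1] at h1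
      refine le_trans (le_of_eq ?_) h1
      rw [hκ]
      simp
      field_simp
      ring
    · intro x hx
      have h1 := measureReal_slice_cone_ge ν kΔ (q := q) (ε := x - 1)
        ⟨by linarith [hx.1], by linarith [hx.2]⟩ hq1
      rw [add_sub_cancel, hk] at h1
      have e : (x - 1) / (q.1 - 1) = κ * (x - 1) := by
        rw [div_eq_iff hh.ne']
        linear_combination -(x - 1) * hκ1
      rwa [e] at h1
  have hdiff : μ (Δ \ C) = 0 := by
    have h1 := measureReal_sdiff hCΔ kC.measurableSet kΔ.measure_lt_top.ne (μ := μ)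
    have h2 : μ.real (Δ \ C) = 0 := le_antisymm (by linarith) measureReal_nonneg
    exact (measureReal_eq_zero_iff (measure_ne_top_of_subset Set.sdiff_subset
      kΔ.measure_lt_top.ne)).1 h2
  refine hCΔ.antisymm ?_
  have hInt : interior Δ ⊆ C := by
    by_contra hne
    obtain ⟨x, hx, hxC⟩ := Set.not_subset.1 hne
    have ho : IsOpen (interior Δ \ C) := isOpen_interior.sdiff kC.isClosed
    refine (ho.measure_pos μ ⟨x, hx, hxC⟩).ne' ?_
    exact measure_mono_null (Set.sdiff_subset_sdiff_left interior_subset) hdiff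
  calc Δ ⊆ closure Δ := subset_closure
    _ = closure (interior Δ) := (cΔ.closure_interior_eq_closure_of_nonempty_interior iΔ).symm
    _ ⊆ C := closure_minimal hInt kC.isClosed

theorem exists_extremePoints_subset_of_altSumBezout
    (hB : AltSumBezout ((volume : Measure ℝ).prod ν) k Δ) :
    ∃ q ∈ Δ, ∀ z ∈ Δ.extremePoints ℝ, z = q ∨ z.1 = 1 := by
  obtain ⟨q, hq, hmax⟩ := kΔ.exists_isMaxOn (iΔ.mono interior_subset)
    (continuous_fst (X := ℝ) (Y := W)).continuousOn
  refine ⟨q, hq, fun z hz => ?_⟩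
  have hΔ1 : ∀ z ∈ Δ, (1 : ℝ) ≤ z.1 := fun z hz => by
    rw [hΔ] at hz
    exact hz.2
  rcases (hΔ1 q hq).eq_or_lt with h1 | h1
  · right
    exact le_antisymm ((hmax hz.1).trans h1.ge) (hΔ1 z hz.1)
  · have h2 := eq_cone_of_altSumBezout ν hk cQ h0 hΔ kΔ iΔ hB hq hmax h1
    have h3 := hz.1
    rw [← h2] at h3
    obtain ⟨⟨s, f⟩, ⟨hs, hf⟩, rfl⟩ := h3
    have hs : s ∈ Set.Icc (0 : ℝ) 1 := hs
    rcases hs.1.eq_or_lt with rfl | hs0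
    · simp
    rcases hs.2.eq_or_lt with rfl | hs1
    · simp
    right
    rw [← hz.2 hf hq ⟨1 - s, s, by linarith, hs0, by ring, rfl⟩]

end ConeCharacterization

section Transfer

open Module

variable {E F : Type*} [NormedAddCommGroup E] [NormedSpace ℝ E] [FiniteDimensional ℝ E]
  [MeasurableSpace E] [BorelSpace E] [NormedAddCommGroup F] [NormedSpace ℝ F]
  [FiniteDimensional ℝ F] [MeasurableSpace F] [BorelSpace F]
  {μ : Measure E} [μ.IsAddHaarMeasure] {ν : Measure F} [ν.IsAddHaarMeasure]
  {k : ℕ} {Δ : Set E}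

omit [FiniteDimensional ℝ E] in
theorem AltSumBezout.singleton_add (h : AltSumBezout μ k Δ) (v : E) :
    AltSumBezout μ k ({v} + Δ) := by
  intro K L cK kK hK cL kL hL
  have := h K L cK kK hK cL kL hL
  simpa only [smul_add, Set.smul_set_singleton, add_left_comm _ ({_} : Set E),
    measureReal_singleton_add] using this

omit [FiniteDimensional ℝ F] in
theorem AltSumBezout.image (h : AltSumBezout μ k Δ) (e : E ≃L[ℝ] F) :
    AltSumBezout ν k (e '' Δ) := by
  intro K L cK kK hK cL kL hL
  obtain ⟨c, hc, hμ⟩ := exists_measureReal_eq_mul_image μ ν e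
  have h1 := h (e.symm '' K) (e.symm '' L) (cK.linear_image e.symm.toLinearMap)
    (kK.image e.symm.continuous) (hK.image _) (cL.linear_image e.symm.toLinearMap)
    (kL.image e.symm.continuous) (hL.image _)
  have es : ∀ A : Set F, e '' (e.symm '' A) = A := fun A => by
    simp [Set.image_image]
  simp only [hμ, Set.image_add, image_smul_set, es, ← mul_sub, ← mul_add, altSum_const_mul] at h1
  refine le_of_mul_le_mul_left ?_ (mul_pos hc hc)
  linarith

/-- If a convex body satisfying the Bezout inequality is obtained from a convex set by a nontrivial
truncation along a hyperplane, then at most one of its extreme points lies off that hyperplane. -/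
theorem AltSumBezout.exists_extremePoints_subset (hB : AltSumBezout μ k Δ)
    (hk : finrank ℝ E = k + 2) {Q : Set E} (cQ : Convex ℝ Q) (y : E →L[ℝ] ℝ) {a : ℝ} {p : E}
    (hp : p ∈ Q) (hpa : a < y p) (hΔ : Δ = Q ∩ {x | y x ≤ a}) (kΔ : IsCompact Δ)
    (iΔ : (interior Δ).Nonempty) :
    ∃ q ∈ Δ, ∀ z ∈ Δ.extremePoints ℝ, z = q ∨ y z = a := by
  have hs : a - y p < 0 := by linarith
  set l : E →L[ℝ] ℝ := (a - y p)⁻¹ • y with hl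
  have hls : ∀ x, l (x - p) = (y x - y p) / (a - y p) := fun x => by
    rw [hl, div_eq_inv_mul, ← map_sub]
    rfl
  obtain ⟨z, hz⟩ := iΔ.mono interior_subset
  have hz2 : y z ≤ a := by rw [hΔ] at hz; exact hz.2
  have hlz : l (z - p) ≠ 0 := by
    rw [hls]
    exact div_ne_zero (by linarith) hs.ne
  set l' : ℝ →L[ℝ] E := ContinuousLinearMap.toSpanSingleton ℝ ((l (z - p))⁻¹ • (z - p)) with hl'
  have hll : Function.RightInverse l' l := by
    intro t
    rw [hl', ContinuousLinearMap.toSpanSingleton_apply, map_smul, map_smul, smul_eq_mul,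
      smul_eq_mul, inv_mul_cancel₀ hlz, mul_one]
  set e := ContinuousLinearEquiv.equivOfRightInverse l l' hll with he
  have he1 : ∀ x, (e x).1 = l x := fun x => ContinuousLinearEquiv.fst_equivOfRightInverse _ _ _ _
  have hle : ∀ x, 1 ≤ l (x - p) ↔ y x ≤ a := by
    intro x
    rw [hls, le_div_iff_of_neg hs]
    constructor <;> intro h <;> linarith
  have heq : ∀ x, l (x - p) = 1 ↔ y x = a := by
    intro x
    rw [hls, div_eq_one_iff_eq hs.ne]
    constructor <;> intro h <;> linarith
  have hW : finrank ℝ (LinearMap.ker (l : E →ₗ[ℝ] ℝ)) = k + 1 := by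
    have h1 := e.toLinearEquiv.finrank_eq
    rw [hk, finrank_prod, finrank_self] at h1
    omega
  set T : E → ℝ × LinearMap.ker (l : E →ₗ[ℝ] ℝ) := fun x => e (-p + x) with hT
  have hTimg : ∀ A : Set E, T '' A = e '' ({-p} + A) := by
    intro A
    rw [Set.singleton_add, Set.image_image]
  have hTc : Continuous T := by fun_prop
  have hTo : IsOpenMap T := e.toHomeomorph.isOpenMap.comp (isOpenMap_add_left (-p))
  have hTi : Function.Injective T := e.injective.comp (add_right_injective (-p))
  have hT1 : ∀ x, (T x).1 = l (x - p) := fun x => by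
    rw [hT]
    dsimp only
    rw [he1, neg_add_eq_sub]
  have hT2 : Convex ℝ (T '' Q) := by
    rw [hTimg]
    exact ((convex_singleton _).add cQ).linear_image e.toLinearMap
  have hT3 : 0 ∈ T '' Q := ⟨p, hp, by simp [hT]⟩
  have hT4 : T '' Δ = T '' Q ∩ {z | 1 ≤ z.1} := by
    rw [hΔ, Set.image_inter hTi]
    ext w
    constructor
    · rintro ⟨h1, x, hx, rfl⟩
      exact ⟨h1, by rw [Set.mem_ofPred_eq, hT1]; exact (hle x).2 hx⟩
    · rintro ⟨⟨x, hx, rfl⟩, h2⟩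
      exact ⟨⟨x, hx, rfl⟩, x, (hle x).1 (by rw [← hT1]; exact h2), rfl⟩
  have hT5 : (interior (T '' Δ)).Nonempty :=
    (iΔ.image T).mono (hTo.image_interior_subset Δ)
  have hT6 : AltSumBezout ((volume : Measure ℝ).prod
      (Measure.addHaar (G := LinearMap.ker (l : E →ₗ[ℝ] ℝ)))) k (T '' Δ) := by
    rw [hTimg]
    exact (hB.singleton_add (-p)).image e
  obtain ⟨q, hq, hq'⟩ := exists_extremePoints_subset_of_altSumBezout
    (Measure.addHaar (G := LinearMap.ker (l : E →ₗ[ℝ] ℝ))) hW hT2 hT3 hT4 (kΔ.image hTc) hT5 hT6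
  obtain ⟨q, hq, rfl⟩ := hq
  refine ⟨q, hq, fun x hx => ?_⟩
  have hx' : T x ∈ (T '' Δ).extremePoints ℝ := by
    refine ⟨⟨x, hx.1, rfl⟩, ?_⟩
    rintro _ ⟨u, hu, rfl⟩ _ ⟨v, hv, rfl⟩ ⟨s, t, hs, ht, hst, h⟩
    refine congrArg T (hx.2 hu hv ⟨s, t, hs, ht, hst, hTi ?_⟩)
    rw [← h]
    simp only [hT, map_add, smul_add, map_smul, map_neg, smul_neg]
    have : s • e p + t • e p = e p := by rw [← add_smul, hst, one_smul]
    linear_combination (norm := module) this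
  rcases hq' _ hx' with h | h
  · exact .inl (hTi h)
  · exact .inr ((heq x).1 (by rw [← hT1, h]))

end Transfer

section MixedVolume

open Module

theorem Fin.sum_finset_succ {M : Type*} [AddCommMonoid M] (n : ℕ) (f : Finset (Fin (n + 1)) → M) :
    ∑ S, f S = ∑ S : Finset (Fin n), f (S.map (Fin.succEmb n)) +
      ∑ S : Finset (Fin n), f (insert 0 (S.map (Fin.succEmb n))) := by
  have h : (Finset.univ : Finset (Fin (n + 1))) =
      insert 0 (Finset.univ.map (Fin.succEmb n)) := by
    rw [Fin.univ_succ, Finset.cons_eq_insert]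
    rfl
  rw [← Finset.powerset_univ, h, Finset.sum_powerset_insert (by simp)]
  have h2 : (Finset.univ.map (Fin.succEmb n)).powerset =
      Finset.univ.map (Finset.mapEmbedding (Fin.succEmb n)).toEmbedding := by
    ext S
    simp only [Finset.mem_powerset, Finset.subset_map_iff, Finset.mem_map, Finset.mem_univ,
      Finset.subset_univ, true_and, eq_comm]
    rfl
  rw [h2, Finset.sum_map, Finset.sum_map]
  rfl

/-- The alternating sum of `v` over the subsums of `K`, all shifted by `B`. -/
def polarization {M : Type*} [AddCommMonoid M] (v : M → ℝ) (n : ℕ) (B : M) (K : Fin n → M) : ℝ :=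
  ∑ S : Finset (Fin n), (-1 : ℝ) ^ (n - S.card) * v (B + ∑ i ∈ S, K i)

theorem polarization_cons {M : Type*} [AddCommMonoid M] (v : M → ℝ) (n : ℕ) (B A : M)
    (K : Fin n → M) :
    polarization v (n + 1) B (Fin.cons A K : Fin (n + 1) → M) =
      polarization v n (B + A) K - polarization v n B K := by
  rw [polarization, Fin.sum_finset_succ, add_comm, sub_eq_add_neg, polarization, polarization,
    ← Finset.sum_neg_distrib]
  congr 1
  · refine Finset.sum_congr rfl fun S _ => ?_
    rw [Finset.card_insert_of_notMem (by simp), Finset.sum_insert (by simp)]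
    simp [add_assoc]
  · refine Finset.sum_congr rfl fun S _ => ?_
    have hS : S.card ≤ n := by simpa using S.card_le_univ
    rw [Finset.card_map, Nat.succ_sub hS, pow_succ]
    simp

variable {E : Type*} [AddCommGroup E] [Module ℝ E]

theorem Convex.sum_const_eq_smul {ι : Type*} {Δ : Set E} (cΔ : Convex ℝ Δ) (hΔ : Δ.Nonempty)
    (S : Finset ι) : ∑ _i ∈ S, Δ = (S.card : ℝ) • Δ := by
  classical
  induction S using Finset.induction_on with
  | empty => simp [Set.zero_smul_set hΔ]
  | insert a S ha ih =>
    rw [Finset.sum_insert ha, ih, Finset.card_insert_of_notMem ha, add_comm]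
    push_cast
    rw [cΔ.add_smul (by positivity) zero_le_one, one_smul]

theorem polarization_const {Δ : Set E} (cΔ : Convex ℝ Δ) (hΔ : Δ.Nonempty) (v : Set E → ℝ)
    (n : ℕ) (B : Set E) :
    polarization v n B (fun _ => Δ) = altSum n (fun c => v (B + (c : ℝ) • Δ)) := by
  simp only [polarization, cΔ.sum_const_eq_smul hΔ, ← Finset.powerset_univ]
  rw [Finset.sum_powerset_apply_card
    (f := fun c => (-1 : ℝ) ^ (n - c) * v (B + (c : ℝ) • Δ))]
  simp only [nsmul_eq_mul, Finset.card_univ, Fintype.card_fin, altSum]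
  exact Finset.sum_congr rfl fun _ _ => by ring

theorem altSum_sub (k : ℕ) (p q : ℕ → ℝ) :
    altSum k (fun c => p c - q c) = altSum k p - altSum k q := by
  simp [altSum, mul_sub, Finset.sum_sub_distrib]

theorem mixedVol_eq_polarization (n : ℕ) (K : Fin n → Set (EuclideanSpace ℝ (Fin n))) :
    mixedVol n K = (n.factorial : ℝ)⁻¹ * polarization volume.real n 0 K := by
  simp [mixedVol, polarization, Measure.real]

variable {k : ℕ} {Δ : Set (EuclideanSpace ℝ (Fin (k + 2)))}

theorem mixedVol_cons_cons_const (cΔ : Convex ℝ Δ) (hΔ : Δ.Nonempty)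
    (K L : Set (EuclideanSpace ℝ (Fin (k + 2)))) :
    mixedVol (k + 2) (Fin.cons K (Fin.cons L (fun _ => Δ) : Fin (k + 1) → Set _)) =
      ((k + 2).factorial : ℝ)⁻¹ * altSum k (fun c => volume.real (K + L + (c : ℝ) • Δ) -
        volume.real (K + (c : ℝ) • Δ) - volume.real (L + (c : ℝ) • Δ) +
        volume.real ((c : ℝ) • Δ)) := by
  rw [mixedVol_eq_polarization, polarization_cons, polarization_cons, polarization_cons]
  simp only [polarization_const cΔ hΔ, zero_add, altSum_sub, altSum_add]
  ring

theorem mixedVol_cons_const (cΔ : Convex ℝ Δ) (hΔ : Δ.Nonempty)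
    (K : Set (EuclideanSpace ℝ (Fin (k + 2)))) :
    mixedVol (k + 2) (Fin.cons K (fun _ => Δ)) =
      ((k + 2).factorial : ℝ)⁻¹ * altSum (k + 1) (fun c => volume.real (K + (c : ℝ) • Δ) -
        volume.real ((c : ℝ) • Δ)) := by
  rw [mixedVol_eq_polarization, polarization_cons]
  simp only [polarization_const cΔ hΔ, zero_add, altSum_sub]

theorem mixedVol_const (cΔ : Convex ℝ Δ) (hΔ : Δ.Nonempty) :
    mixedVol (k + 2) (fun _ => Δ) = volume.real Δ := by
  rw [mixedVol_eq_polarization, polarization_const cΔ hΔ]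
  have h : ∀ c : ℕ, volume.real ((0 : Set _) + (c : ℝ) • Δ) = volume.real Δ * (c : ℝ) ^ (k + 2) := by
    intro c
    rw [zero_add, measureReal_smul_of_nonneg _ _ (by positivity), finrank_euclideanSpace_fin,
      mul_comm]
  simp only [h, altSum_const_mul, altSum_pow]
  field_simp

theorem altSumBezout_of_mixedVol (cΔ : Convex ℝ Δ) (kΔ : IsCompact Δ) (iΔ : (interior Δ).Nonempty)
    (r : ℕ) (h : ∀ K : Fin (r + 2) → Set (EuclideanSpace ℝ (Fin (k + 2))),
      (∀ i, IsConvexBody (K i)) →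
      mixedVol (k + 2) (fun j => if h : (j : ℕ) < r + 2 then K ⟨(j : ℕ), h⟩ else Δ) *
          (mixedVol (k + 2) (fun _ => Δ)) ^ (r + 1) ≤
        ∏ i, mixedVol (k + 2) (fun j => if (j : ℕ) = 0 then K i else Δ)) :
    AltSumBezout volume k Δ := by
  intro K L cK kK hK cL kL hL
  have hΔ := iΔ.mono interior_subset
  have hV := measureReal_pos_of_interior_nonempty volume kΔ iΔ
  have h1 := h (Fin.cons K (Fin.cons L (fun _ => Δ) : Fin (r + 1) → Set _)) fun i => by
    refine Fin.cases ⟨cK, kK, hK⟩ (fun i => ?_) i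
    exact Fin.cases ⟨cL, kL, hL⟩ (fun i => ⟨cΔ, kΔ, hΔ⟩) i
  have e1 : (fun j : Fin (k + 2) => if h : (j : ℕ) < r + 2 then
      (Fin.cons K (Fin.cons L (fun _ => Δ) : Fin (r + 1) → Set _) :
        Fin (r + 2) → Set (EuclideanSpace ℝ (Fin (k + 2)))) ⟨(j : ℕ), h⟩ else Δ) =
      Fin.cons K (Fin.cons L (fun _ => Δ) : Fin (k + 1) → Set _) := by
    ext1 j
    refine Fin.cases ?_ (fun i => ?_) j
    · simp
    · refine Fin.cases ?_ (fun i => ?_) i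
      · simp
      · simp only [Fin.cons_succ, dite_eq_right_iff]
        exact fun _ => rfl
  have e2 : ∀ A : Set (EuclideanSpace ℝ (Fin (k + 2))),
      (fun j : Fin (k + 2) => if (j : ℕ) = 0 then A else Δ) = Fin.cons A (fun _ => Δ) := by
    intro A
    ext1 j
    refine Fin.cases ?_ (fun i => ?_) j <;> simp
  have e3 : (Fin.cons Δ (fun _ => Δ) : Fin (k + 2) → Set (EuclideanSpace ℝ (Fin (k + 2)))) =
      fun _ => Δ := by
    ext1 j
    refine Fin.cases ?_ (fun i => ?_) j <;> simp
  rw [e1] at h1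
  simp only [e2, Fin.prod_univ_succ, Fin.cons_zero, Fin.cons_succ, e3, mixedVol_const cΔ hΔ,
    Finset.prod_const, Finset.card_univ, Fintype.card_fin] at h1
  rw [mixedVol_cons_cons_const cΔ hΔ, mixedVol_cons_const cΔ hΔ, mixedVol_cons_const cΔ hΔ] at h1
  refine le_of_mul_le_mul_left ?_ (a := ((k + 2).factorial : ℝ)⁻¹ ^ 2 * volume.real Δ ^ r)
    (by positivity)
  have hf : ((k + 2).factorial : ℝ) ≠ 0 := by positivity
  calc _ = _ := ?_
    _ ≤ _ := h1
    _ = _ := by ring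
  field_simp
  ring

end MixedVolume

section Polytope

open Module

variable {E : Type*} [NormedAddCommGroup E] [InnerProductSpace ℝ E]

theorem finite_extremePoints_halfSpaces (s : Finset E) :
    ({u : E | ∀ v ∈ s, inner ℝ v u ≤ 1}.extremePoints ℝ).Finite := by
  classical
  refine Set.Finite.of_injOn (f := fun u => s.filter fun v => inner ℝ v u = 1) (t := s.powerset)
    (fun u _ => Finset.mem_coe.2 (Finset.mem_powerset.2 (Finset.filter_subset _ _))) ?_
    (Finset.finite_toSet _)
  intro u hu u' hu' h
  have hact : ∀ v ∈ s, inner ℝ v u = 1 → inner ℝ v (u' - u) = 0 := by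
    intro v hv h1
    have : v ∈ s.filter fun v => inner ℝ v u' = 1 := by
      rw [← show (s.filter fun v => inner ℝ v u = 1) = s.filter fun v => inner ℝ v u' = 1 from h]
      simp [hv, h1]
    rw [inner_sub_right, (Finset.mem_filter.1 this).2, h1, sub_self]
  have hev : ∀ᶠ δ : ℝ in nhds 0, ∀ v ∈ s, inner ℝ v (u + δ • (u' - u)) ≤ 1 := by
    rw [Filter.eventually_all_finset]
    intro v hv
    by_cases h1 : inner ℝ v u = 1
    · refine .of_forall fun δ => ?_
      rw [inner_add_right, inner_smul_right, hact v hv h1, h1]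
      simp
    · have h2 : inner ℝ v u < 1 := lt_of_le_of_ne (hu.1 v hv) h1
      have hc : Filter.Tendsto (fun δ : ℝ => inner ℝ v (u + δ • (u' - u))) (nhds 0)
          (nhds (inner ℝ v u)) := by
        have : Continuous fun δ : ℝ => inner ℝ v (u + δ • (u' - u)) := by fun_prop
        simpa using this.tendsto 0
      exact (hc.eventually_lt_const h2).mono fun _ => le_of_lt
  obtain ⟨ε, hε, hball⟩ := Metric.eventually_nhds_iff.1 hev
  have h1 := hball (y := ε / 2) (by rw [Real.dist_eq, sub_zero, abs_of_pos] <;> linarith)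
  have h2 := hball (y := -(ε / 2)) (by rw [Real.dist_eq, sub_zero, abs_neg, abs_of_pos] <;> linarith)
  have h3 := hu.2 h1 h2 ⟨1 / 2, 1 / 2, by norm_num, by norm_num, by norm_num, by module⟩
  rw [add_eq_left, smul_eq_zero, sub_eq_zero] at h3
  rcases h3 with h3 | h3
  · linarith
  · exact h3.symm

variable [FiniteDimensional ℝ E]

/-- A polytope containing the origin in its interior is a finite intersection of half-spaces. -/
theorem exists_halfSpaces_of_zero_mem_interior (s : Finset E)
    (h0 : 0 ∈ interior (convexHull ℝ (s : Set E))) :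
    ∃ t : Finset E, ∀ x, x ∈ convexHull ℝ (s : Set E) ↔ ∀ w ∈ t, inner ℝ w x ≤ 1 := by
  set P := {u : E | ∀ v ∈ s, inner ℝ v u ≤ 1} with hP
  have hPc : ∀ u ∈ P, ∀ x ∈ convexHull ℝ (s : Set E), inner ℝ u x ≤ 1 := by
    intro u hu x hx
    have : Convex ℝ {x | (innerSL ℝ u) x ≤ 1} :=
      convex_halfSpace_le (innerSL ℝ u).toLinearMap.isLinear 1
    exact convexHull_min (fun v hv => by simpa [real_inner_comm] using hu v hv) this hx
  have kP : IsCompact P := by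
    refine Metric.isCompact_of_isClosed_isBounded ?_ ?_
    · simp only [hP, Set.ofPred_forall]
      exact isClosed_biInter fun v _ => isClosed_le (by fun_prop) continuous_const
    · obtain ⟨ρ, hρ, hball⟩ := Metric.mem_nhds_iff.1 (mem_interior_iff_mem_nhds.1 h0)
      refine (Metric.isBounded_closedBall (x := (0 : E)) (r := 2 / ρ)).subset fun u hu => ?_
      rw [mem_closedBall_zero_iff]
      by_contra! hlt
      have hu0 : 0 < ‖u‖ := lt_trans (by positivity) hlt
      have h1 := hPc u hu ((ρ / 2 / ‖u‖) • u) (hball (by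
        rw [mem_ball_zero_iff, norm_smul, Real.norm_of_nonneg (by positivity)]
        field_simp
        norm_num))
      rw [inner_smul_right, real_inner_self_eq_norm_sq] at h1
      have e : ρ / 2 / ‖u‖ * ‖u‖ ^ 2 = ρ / 2 * ‖u‖ := by field_simp
      rw [e] at h1
      rw [div_lt_iff₀ hρ] at hlt
      linarith
  have cP : Convex ℝ P := by
    simp only [hP, Set.ofPred_forall]
    exact convex_iInter₂ fun v _ =>
      convex_halfSpace_le (innerSL ℝ v).toLinearMap.isLinear 1
  have hfin := finite_extremePoints_halfSpaces s
  refine ⟨hfin.toFinset, fun x => ⟨fun hx w hw => hPc w (hfin.mem_toFinset.1 hw).1 x hx,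
    fun hx => ?_⟩⟩
  by_contra hxn
  obtain ⟨f, a, hfa, hax⟩ := geometric_hahn_banach_closed_point (convex_convexHull ℝ _)
    (s.finite_toSet.isCompact_convexHull ℝ).isClosed hxn
  have ha : 0 < a := by simpa using hfa 0 (interior_subset h0)
  set u := (InnerProductSpace.toDual ℝ E).symm f with hu
  have hfu : ∀ x, f x = inner ℝ u x := fun x => by simp [hu]
  have huP : a⁻¹ • u ∈ P := by
    intro v hv
    rw [inner_smul_right, real_inner_comm, ← hfu, inv_mul_le_iff₀ ha, mul_one]
    exact (hfa v (subset_convexHull ℝ _ hv)).le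
  have hPx : P ⊆ {u | inner ℝ u x ≤ 1} := by
    rw [← closure_convexHull_extremePoints kP cP]
    refine closure_minimal (convexHull_min (fun w hw => hx w (hfin.mem_toFinset.2 hw)) ?_) ?_
    · have := convex_halfSpace_le (innerSL ℝ x).toLinearMap.isLinear 1
      simpa [real_inner_comm] using this
    · exact isClosed_le (by fun_prop) continuous_const
  have h1 : inner ℝ (a⁻¹ • u) x ≤ 1 := hPx huP
  rw [real_inner_smul_left, ← hfu, inv_mul_le_iff₀ ha, mul_one] at h1
  linarith

theorem exists_halfSpaces_of_mem_interior (s : Finset E) {z : E}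
    (hz : z ∈ interior (convexHull ℝ (s : Set E))) :
    ∃ t : Finset E, ∀ x, x ∈ convexHull ℝ (s : Set E) ↔ ∀ w ∈ t, inner ℝ w (x - z) ≤ 1 := by
  classical
  have hs : convexHull ℝ ((s.image fun x => x - z : Finset E) : Set E) =
      (fun x => x - z) '' convexHull ℝ (s : Set E) := by
    rw [Finset.coe_image]
    have := (AffineMap.image_convexHull (𝕜 := ℝ) (AffineEquiv.vaddConst ℝ z).symm.toAffineMap
      (s : Set E)).symm
    exact this
  have h0 : 0 ∈ interior (convexHull ℝ ((s.image fun x => x - z : Finset E) : Set E)) := by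
    rw [hs]
    exact (Homeomorph.subRight z).isOpenMap.image_interior_subset _ ⟨z, hz, by simp⟩
  obtain ⟨t, ht⟩ := exists_halfSpaces_of_zero_mem_interior _ h0
  refine ⟨t, fun x => ?_⟩
  rw [← ht, hs]
  exact (sub_left_injective.mem_set_image).symm

/-- A polytope all of whose nontrivial truncations leave at most one extreme point off the
truncating hyperplane is a simplex. -/
theorem exists_affineIndependent_of_truncation [Nontrivial E] {Δ : Set E} (s : Finset E)
    (hs : Δ = convexHull ℝ (s : Set E)) (iΔ : (interior Δ).Nonempty)
    (h : ∀ (Q : Set E) (y : E →L[ℝ] ℝ) (a : ℝ) (p : E), Convex ℝ Q → p ∈ Q → a < y p →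
      Δ = Q ∩ {x | y x ≤ a} → ∃ q ∈ Δ, ∀ z ∈ Δ.extremePoints ℝ, z = q ∨ y z = a) :
    ∃ p : Fin (finrank ℝ E + 1) → E, AffineIndependent ℝ p ∧ Δ = convexHull ℝ (Set.range p) := by
  classical
  obtain ⟨z, hz⟩ := id iΔ
  have kΔ : IsCompact Δ := hs ▸ s.finite_toSet.isCompact_convexHull ℝ
  have cΔ : Convex ℝ Δ := hs ▸ convex_convexHull ℝ _
  obtain ⟨t₀, ht₀⟩ := exists_halfSpaces_of_mem_interior s (hs ▸ hz)
  rw [← hs] at ht₀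
  obtain ⟨t, -, ht, hmin⟩ := exists_minimal_le_of_wellFoundedLT
    (fun t : Finset E => ∀ x, x ∈ Δ ↔ ∀ w ∈ t, inner ℝ w (x - z) ≤ 1) t₀ ht₀
  have hsep : ∀ x ∈ Δ.extremePoints ℝ, ∃ (y : E →L[ℝ] ℝ) (a : ℝ), y x ≠ a ∧
      ∀ x' ∈ Δ.extremePoints ℝ, x' ≠ x → y x' = a := by
    intro x hx
    have hw : ∃ w ∈ t, inner ℝ w (x - z) ≠ 1 := by
      by_contra! hall
      obtain ⟨v, hv, hvx⟩ : ∃ v ∈ Δ, v ≠ x := by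
        by_contra! hsub
        have : (nhdsWithin x {x}ᶜ).NeBot := Module.punctured_nhds_neBot ℝ E x
        have h1 : interior Δ ⊆ interior {x} := interior_mono hsub
        rw [interior_singleton] at h1
        exact h1 hz
      have hray : ∀ r : ℝ, 0 ≤ r → x + r • (v - x) ∈ Δ := by
        intro r hr
        refine (ht _).2 fun w hw => ?_
        have e : x + r • (v - x) - z = (x - z) + r • ((v - z) - (x - z)) := by module
        rw [e, inner_add_right, inner_smul_right,
          inner_sub_right w (v - z), hall w hw]
        nlinarith [(ht v).1 hv w hw]
      obtain ⟨R, hR, hRΔ⟩ := kΔ.isBounded.subset_closedBall_lt 0 x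
      have hvx' : 0 < ‖v - x‖ := norm_pos_iff.2 (sub_ne_zero.2 hvx)
      have h1 := hRΔ (hray (2 * R / ‖v - x‖) (by positivity))
      rw [Metric.mem_closedBall, dist_eq_norm, add_sub_cancel_left, norm_smul,
        Real.norm_of_nonneg (by positivity), div_mul_cancel₀ _ hvx'.ne'] at h1
      linarith
    obtain ⟨w, hw, hwx⟩ := hw
    obtain ⟨p, hp, hwp⟩ : ∃ p, (∀ w' ∈ t.erase w, inner ℝ w' (p - z) ≤ 1) ∧
        1 < inner ℝ w (p - z) := by
      by_contra! hcon
      have h1 := hmin (y := t.erase w) (fun x => ⟨fun hx w' hw' =>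
        (ht x).1 hx w' (Finset.mem_of_mem_erase hw'), fun hx => (ht x).2 fun w' hw' => ?_⟩)
        (Finset.erase_subset _ _)
      · exact Finset.notMem_erase w t (h1 hw)
      · rcases eq_or_ne w' w with rfl | hne
        · exact hcon x hx
        · exact hx w' (Finset.mem_erase.2 ⟨hne, hw'⟩)
    have hin : ∀ x, inner ℝ w (x - z) = innerSL ℝ w x - inner ℝ w z := fun x => by
      rw [inner_sub_right]; rfl
    have hQc : Convex ℝ {x | ∀ w' ∈ t.erase w, inner ℝ w' (x - z) ≤ 1} := by
      simp only [Set.ofPred_forall, inner_sub_right, sub_le_iff_le_add]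
      exact convex_iInter₂ fun v _ => convex_halfSpace_le (innerSL ℝ v).toLinearMap.isLinear _
    have hQΔ : Δ = {x | ∀ w' ∈ t.erase w, inner ℝ w' (x - z) ≤ 1} ∩
        {x | innerSL ℝ w x ≤ 1 + inner ℝ w z} := by
      ext x
      rw [ht x]
      constructor
      · intro hx
        refine ⟨fun w' hw' => hx w' (Finset.mem_of_mem_erase hw'), ?_⟩
        have := hx w hw
        rw [hin] at this
        rw [Set.mem_ofPred_eq]
        linarith
      · rintro ⟨h1, h2⟩ w' hw'
        rw [Set.mem_ofPred_eq] at h2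
        rcases eq_or_ne w' w with rfl | hne
        · rw [hin]
          linarith
        · exact h1 w' (Finset.mem_erase.2 ⟨hne, hw'⟩)
    obtain ⟨q, -, hq⟩ := h _ (innerSL ℝ w) (1 + inner ℝ w z) p hQc hp (by linarith [hin p]) hQΔ
    refine ⟨innerSL ℝ w, 1 + inner ℝ w z, fun h1 => hwx (by linarith [hin x]), fun x' hx' hne => ?_⟩
    have hxq : x = q := (hq x hx).resolve_right fun h1 => hwx (by linarith [hin x])
    exact (hq x' hx').resolve_left (hxq ▸ hne)
  have hfin : (Δ.extremePoints ℝ).Finite := by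
    rw [hs]
    exact s.finite_toSet.subset extremePoints_convexHull_subset
  have hconv : convexHull ℝ (Δ.extremePoints ℝ) = Δ := by
    rw [← (hfin.isCompact_convexHull ℝ).isClosed.closure_eq]
    exact closure_convexHull_extremePoints kΔ cΔ
  have := hfin.fintype
  have hind : AffineIndependent ℝ ((↑) : Δ.extremePoints ℝ → E) := by
    rw [affineIndependent_iff]
    intro S c hc hc' i hi
    obtain ⟨y, a, hya, hy⟩ := hsep i i.2
    have h1 : ∑ j ∈ S, c j * (y j - a) = 0 := by
      simp only [mul_sub, Finset.sum_sub_distrib, ← Finset.sum_mul, hc, zero_mul, sub_zero]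
      simpa using congrArg y hc'
    rw [Finset.sum_eq_single i] at h1
    · exact (mul_eq_zero.1 h1).resolve_right (sub_ne_zero.2 hya)
    · intro j _ hji
      rw [hy j j.2 (fun e => hji (Subtype.ext e)), sub_self, mul_zero]
    · exact fun hn => absurd hi hn
  have hspan : affineSpan ℝ (Set.range ((↑) : Δ.extremePoints ℝ → E)) = ⊤ := by
    rw [Subtype.range_coe, ← affineSpan_convexHull, hconv]
    exact affineSpan_eq_top_of_nonempty_interior (by rwa [cΔ.convexHull_eq])
  have hcard := hind.affineSpan_eq_top_iff_card_eq_finrank_add_one.1 hspan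
  let e : Fin (finrank ℝ E + 1) ≃ Δ.extremePoints ℝ := (Fintype.equivFinOfCardEq hcard).symm
  refine ⟨(↑) ∘ e, hind.comp_embedding e.toEmbedding, ?_⟩
  rw [e.surjective.range_comp, Subtype.range_coe, hconv]

end Polytope

/-- If an `n`-dimensional convex polytope `Δ` in `ℝⁿ` satisfies the Bezout inequality
`V(K₁,…,K_r,Δ[n-r]) V_n(Δ)^{r-1} ≤ ∏ᵢ V(Kᵢ,Δ[n-1])` for all convex bodies `K₁,…,K_r`,
then `Δ` is a simplex. -/
theorem simplex_of_bezout (n r : ℕ) (hr2 : 2 ≤ r) (hrn : r ≤ n)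
    (Δ : Set (EuclideanSpace ℝ (Fin n)))
    (hpoly : ∃ s : Finset (EuclideanSpace ℝ (Fin n)), Δ = convexHull ℝ (s : Set _))
    (hdim : (interior Δ).Nonempty)
    (hBezout : ∀ K : Fin r → Set (EuclideanSpace ℝ (Fin n)), (∀ i, IsConvexBody (K i)) →
      mixedVol n (fun j : Fin n => if h : (j : ℕ) < r then K ⟨(j : ℕ), h⟩ else Δ) *
          (mixedVol n (fun _ => Δ)) ^ (r - 1) ≤
        ∏ i : Fin r, mixedVol n (fun j : Fin n => if (j : ℕ) = 0 then K i else Δ)) :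
    ∃ p : Fin (n + 1) → EuclideanSpace ℝ (Fin n),
      AffineIndependent ℝ p ∧ Δ = convexHull ℝ (Set.range p) := by
  obtain ⟨k, rfl⟩ : ∃ k, n = k + 2 := ⟨n - 2, by omega⟩
  obtain ⟨r, rfl⟩ : ∃ r', r = r' + 2 := ⟨r - 2, by omega⟩
  obtain ⟨s, hs⟩ := hpoly
  have cΔ : Convex ℝ Δ := hs ▸ convex_convexHull ℝ _
  have kΔ : IsCompact Δ := hs ▸ s.finite_toSet.isCompact_convexHull ℝ
  have hB := altSumBezout_of_mixedVol cΔ kΔ hdim r hBezout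
  have hn : Module.finrank ℝ (EuclideanSpace ℝ (Fin (k + 2))) = k + 2 := finrank_euclideanSpace_fin
  have : Nontrivial (EuclideanSpace ℝ (Fin (k + 2))) :=
    Module.nontrivial_of_finrank_pos (R := ℝ) (by omega)
  have h := exists_affineIndependent_of_truncation s hs hdim fun Q y a p cQ hp hpa hΔ =>
    hB.exists_extremePoints_subset hn cQ y hp hpa hΔ kΔ hdim
  rwa [hn] at h
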